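/- arXiv:2310.00988 — 6 statements merged into one kernel-verified Lean document; each statement's English description precedes it below -/
import Mathlib

section
/- Let r, p, q be real numbers with r ≤ p ≤ q and r < q, let μ : ℕ → ℝ be a sequence with μ n > 0 for all n, and let x : ℕ → ℂ be a sequence such that ∑ (μ n)^(2q) * ‖x n‖^2 and ∑ (μ n)^(2r) * ‖x n‖^2 are both finite. Then (∑ (μ n)^(2p) * ‖x n‖^2)^(1/2) ≤ (∑ (μ n)^(2q) * ‖x n‖^2)^((p−r)/(2(q−r))) * (∑ (μ n)^(2r) * ‖x n‖^2)^((q−p)/(2(q−r))). -/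
open scoped BigOperators

/-- Hölder's inequality in weighted geometric mean form: for `s + t = 1`,
`∑ aᵢ ^ s * bᵢ ^ t ≤ (∑ aᵢ) ^ s * (∑ bᵢ) ^ t`. -/
theorem tsum_rpow_mul_rpow_le {ι : Type*} {a b : ι → ℝ} {s t : ℝ} (hs : 0 ≤ s) (ht : 0 ≤ t)
    (hst : s + t = 1) (ha : ∀ i, 0 ≤ a i) (hb : ∀ i, 0 ≤ b i) (hsa : Summable a)
    (hsb : Summable b) :
    ∑' i, a i ^ s * b i ^ t ≤ (∑' i, a i) ^ s * (∑' i, b i) ^ t := by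
  rcases hs.eq_or_lt with rfl | hs
  · obtain rfl : t = 1 := by linarith
    simp
  rcases ht.eq_or_lt with rfl | ht
  · obtain rfl : s = 1 := by linarith
    simp
  have key (i) : (a i ^ s) ^ s⁻¹ = a i := Real.rpow_rpow_inv (ha i) hs.ne'
  have key' (i) : (b i ^ t) ^ t⁻¹ = b i := Real.rpow_rpow_inv (hb i) ht.ne'
  have h := Real.inner_le_Lp_mul_Lq_tsum_of_nonneg (Real.HolderConjugate.inv_inv hs ht hst)
    (f := fun i => a i ^ s) (g := fun i => b i ^ t)
    (fun i => Real.rpow_nonneg (ha i) s) (fun i => Real.rpow_nonneg (hb i) t)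
    (by simpa only [key] using hsa) (by simpa only [key'] using hsb)
  simpa only [key, key', one_div, inv_inv] using h

/-- Interpolation (moment) inequality `‖A^p x‖ ≤ ‖A^q x‖^((p−r)/(q−r)) ‖A^r x‖^((q−p)/(q−r))`
for a self-adjoint positive definite operator `A` with compact resolvent, realized in its
orthonormal eigenbasis as multiplication by the positive eigenvalue sequence `μ n`, so that
`‖A^s x‖² = ∑ (μ n)^(2s) ‖x n‖²`. -/
theorem interpolation_inequality (r p q : ℝ) (hrp : r ≤ p) (hpq : p ≤ q) (hrq : r < q)
    (μ : ℕ → ℝ) (hμ : ∀ n, 0 < μ n) (x : ℕ → ℂ)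
    (hsq : Summable fun n => μ n ^ (2 * q) * ‖x n‖ ^ 2)
    (hsr : Summable fun n => μ n ^ (2 * r) * ‖x n‖ ^ 2) :
    (∑' n, μ n ^ (2 * p) * ‖x n‖ ^ 2) ^ ((1 : ℝ) / 2) ≤
      (∑' n, μ n ^ (2 * q) * ‖x n‖ ^ 2) ^ ((p - r) / (2 * (q - r))) *
        (∑' n, μ n ^ (2 * r) * ‖x n‖ ^ 2) ^ ((q - p) / (2 * (q - r))) := by
  have hd : 0 < q - r := sub_pos.2 hrq
  have hs : 0 ≤ (p - r) / (q - r) := div_nonneg (sub_nonneg.2 hrp) hd.le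
  have ht : 0 ≤ (q - p) / (q - r) := div_nonneg (sub_nonneg.2 hpq) hd.le
  have hst : (p - r) / (q - r) + (q - p) / (q - r) = 1 := by field_simp; ring
  have hnonneg (e : ℝ) (n : ℕ) : 0 ≤ μ n ^ (2 * e) * ‖x n‖ ^ 2 :=
    mul_nonneg (Real.rpow_nonneg (hμ n).le _) (sq_nonneg _)
  have hterm (n : ℕ) : μ n ^ (2 * p) * ‖x n‖ ^ 2 =
      (μ n ^ (2 * q) * ‖x n‖ ^ 2) ^ ((p - r) / (q - r)) *
        (μ n ^ (2 * r) * ‖x n‖ ^ 2) ^ ((q - p) / (q - r)) := by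
    have hexp : 2 * q * ((p - r) / (q - r)) + 2 * r * ((q - p) / (q - r)) = 2 * p := by
      field_simp; ring
    rw [Real.mul_rpow (Real.rpow_nonneg (hμ n).le _) (sq_nonneg _),
      Real.mul_rpow (Real.rpow_nonneg (hμ n).le _) (sq_nonneg _), mul_mul_mul_comm,
      ← Real.rpow_mul (hμ n).le, ← Real.rpow_mul (hμ n).le, ← Real.rpow_add (hμ n), hexp,
      ← Real.rpow_add_of_nonneg (sq_nonneg _) hs ht, hst, Real.rpow_one]
  have h := tsum_rpow_mul_rpow_le hs ht hst (hnonneg q) (hnonneg r) hsq hsr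
  simp only [← hterm] at h
  have hsum (e : ℝ) : 0 ≤ ∑' n, μ n ^ (2 * e) * ‖x n‖ ^ 2 := tsum_nonneg (hnonneg e)
  refine (Real.rpow_le_rpow (hsum p) h (by norm_num)).trans_eq ?_
  rw [Real.mul_rpow (Real.rpow_nonneg (hsum q) _) (Real.rpow_nonneg (hsum r) _),
    ← Real.rpow_mul (hsum q), ← Real.rpow_mul (hsum r), div_mul_div_comm, div_mul_div_comm,
    mul_one, mul_one, mul_comm (q - r) 2]
end

section
/- Assume 1/2 < α < (β+1)/2, 0 < β ≤ 1, and 0 < γ < 2α − β (region T₁). Then there exist M > 0 and functions λ₁, λ₃ : ℝ → ℂ such that for every μ > M, λ₁(μ), its complex conjugate, λ₃(μ), and its complex conjugate are roots of f(·, μ), and as μ → ∞: Re λ₁(μ) = −(1/2)μ^(−2α+β+γ)(1+o(1)), Im λ₁(μ) = μ^(α−γ/2)(1+o(1)), Re λ₃(μ) = −(1/2)(1+o(1)), and Im λ₃(μ) = √2 · μ^(−α+β/2+1/2)(1+o(1)). -/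
open Filter Real Topology

/-- Characteristic polynomial of the thermoelastic system with Cattaneo's law,
with inertial coefficient `m = 1`, wave speed `σ = 2`, relaxation `τ = 1`:
`f(λ, μ) = (μ^γ+1)λ⁴ + (μ^γ+1)λ³ + (μ^(2α)+μ^(β+γ)+2μ+μ^β)λ² + (μ^(2α)+2μ)λ + 2μ^(1+β)`. -/
noncomputable def charPoly (α β γ μ : ℝ) (l : ℂ) : ℂ :=
  ((μ ^ γ + 1 : ℝ) : ℂ) * l ^ 4 + ((μ ^ γ + 1 : ℝ) : ℂ) * l ^ 3 +
    ((μ ^ (2 * α) + μ ^ (β + γ) + 2 * μ + μ ^ β : ℝ) : ℂ) * l ^ 2 +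
    ((μ ^ (2 * α) + 2 * μ : ℝ) : ℂ) * l + ((2 * μ ^ (1 + β) : ℝ) : ℂ)

/-- A monic real quartic `x⁴ + x³ + (C + b)x² + Cx + D` whose coefficient `C` dominates `b`
splits into two real quadratics; `q` and `p` are the coefficients of one of them. -/
lemma exists_quadratic_factor {C b D : ℝ} (hb : 0 < b) (hD : 0 < D) (hDC : D ≤ b * C)
    (hC : 2 * b < C) :
    ∃ q p : ℝ, C ≤ q ∧ q ≤ C + b ∧ 0 ≤ p ∧ p ≤ 1 ∧
      q + D / q + p * (1 - p) = C + b ∧ p * (q - D / q) = q - C := by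
  have hC0 : 0 < C := by linarith
  have hs : ∀ q, C ≤ q → D / q ≤ b := fun q hq => by
    rw [div_le_iff₀ (by linarith)]
    nlinarith
  have hd : ∀ q, C ≤ q → b < q - D / q := fun q hq => by linarith [hs q hq]
  have hp : ∀ q, C ≤ q → q ≤ C + b →
      0 ≤ (q - C) / (q - D / q) ∧ (q - C) / (q - D / q) ≤ 1 := fun q hq hq' => by
    have := hd q hq
    refine ⟨div_nonneg (by linarith) (by linarith), ?_⟩
    rw [div_le_one (by linarith)]
    linarith
  have hcont : ContinuousOn (fun q : ℝ => q + D / q +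
      (q - C) / (q - D / q) * (1 - (q - C) / (q - D / q))) (Set.Icc C (C + b)) := by
    have h0 : ∀ q ∈ Set.Icc C (C + b), q ≠ 0 := fun q hq => by linarith [hq.1]
    have h1 : ∀ q ∈ Set.Icc C (C + b), q - D / q ≠ 0 := fun q hq => by linarith [hd q hq.1]
    have hDq : ContinuousOn (fun q : ℝ => D / q) (Set.Icc C (C + b)) :=
      continuousOn_const.div continuousOn_id h0
    have hpq : ContinuousOn (fun q : ℝ => (q - C) / (q - D / q)) (Set.Icc C (C + b)) :=
      (continuousOn_id.sub continuousOn_const).div (continuousOn_id.sub hDq) h1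
    exact (continuousOn_id.add hDq).add (hpq.mul (continuousOn_const.sub hpq))
  obtain ⟨q, hq, hqe⟩ := intermediate_value_Icc (by linarith : C ≤ C + b) hcont
    (show C + b ∈ Set.Icc _ _ by
      constructor
      · simpa using hs C le_rfl
      · have h := hp (C + b) (by linarith) le_rfl
        have h' : 0 < D / (C + b) := by positivity
        have := mul_nonneg h.1 (sub_nonneg.2 h.2)
        linarith)
  have h := hp q hq.1 hq.2
  refine ⟨q, _, hq.1, hq.2, h.1, h.2, hqe, ?_⟩
  exact div_mul_cancel₀ _ (by linarith [hd q hq.1])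

lemma quadratic_root {p q : ℝ} (h : p ^ 2 / 4 ≤ q) {y : ℝ} (hy : y ^ 2 = (√(q - p ^ 2 / 4)) ^ 2) :
    (⟨-p / 2, y⟩ : ℂ) ^ 2 + p * ⟨-p / 2, y⟩ + q = 0 := by
  rw [Real.sq_sqrt (by linarith)] at hy
  apply Complex.ext <;> simp [pow_two] <;> nlinarith

lemma charPoly_eq_mul {α β γ μ p q r s a C b D : ℝ}
    (ha : μ ^ γ + 1 = a) (hC : μ ^ (2 * α) + 2 * μ = a * C)
    (hB : μ ^ (2 * α) + μ ^ (β + γ) + 2 * μ + μ ^ β = a * (C + b))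
    (hD : 2 * μ ^ (1 + β) = a * D)
    (h3 : p + r = 1) (h2 : q + s + p * r = C + b) (h1 : p * s + q * r = C) (h0 : q * s = D)
    (l : ℂ) :
    charPoly α β γ μ l = a * ((l ^ 2 + p * l + q) * (l ^ 2 + r * l + s)) := by
  rw [charPoly, ha, hC, hB, hD, ← h0, ← h2, ← h1]
  have h3' : (p : ℂ) + r = 1 := by exact_mod_cast h3
  push_cast
  linear_combination (-(a : ℂ) * l ^ 3) * h3'

/-- Asymptotics of the coefficients of the two quadratic factors. -/
lemma exists_quadratic_factor_asymptotics {ι : Type*} {l : Filter ι} {m G E b : ι → ℝ}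
    (hm : ∀ᶠ x in l, 0 < m x) (hG : ∀ᶠ x in l, 0 < G x) (hE : ∀ᶠ x in l, 0 < E x)
    (hb : ∀ᶠ x in l, 0 < b x)
    (tG : Tendsto (fun x => (G x)⁻¹) l (𝓝 0)) (tE : Tendsto (fun x => (E x)⁻¹) l (𝓝 0))
    (tb : Tendsto (fun x => (b x)⁻¹) l (𝓝 0))
    (tm : Tendsto (fun x => m x / (E x * G x)) l (𝓝 0))
    (tbE : Tendsto (fun x => b x / E x) l (𝓝 0))
    (tW : Tendsto (fun x => E x * G x / (m x * b x)) l (𝓝 0)) :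
    ∃ q p s : ι → ℝ,
      (∀ᶠ x in l, q x + s x + p x * (1 - p x) = (E x * G x + 2 * m x) / (G x + 1) + b x ∧
        p x * s x + q x * (1 - p x) = (E x * G x + 2 * m x) / (G x + 1) ∧
        q x * s x = 2 * (m x * b x) / (G x + 1) ∧
        p x ^ 2 / 4 ≤ q x ∧ (1 - p x) ^ 2 / 4 ≤ s x) ∧
      Tendsto p l (𝓝 0) ∧
      Tendsto (fun x => p x / (b x / E x)) l (𝓝 1) ∧
      Tendsto (fun x => (q x - p x ^ 2 / 4) / E x) l (𝓝 1) ∧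
      Tendsto (fun x => (s x - (1 - p x) ^ 2 / 4) / (2 * (m x * b x / (E x * G x)))) l (𝓝 1) := by
  have tC : Tendsto (fun x => (E x * G x + 2 * m x) / (G x + 1) / E x) l (𝓝 1) := by
    have h : Tendsto (fun x => (1 + 2 * (m x / (E x * G x))) / (1 + (G x)⁻¹)) l
        (𝓝 ((1 + 2 * 0) / (1 + 0))) :=
      ((tm.const_mul 2).const_add 1).div (tG.const_add 1) (by norm_num)
    norm_num at h
    refine h.congr' ?_
    filter_upwards [hG, hE] with x hG hE
    field_simp
  have hC : ∀ᶠ x in l, 2 * b x < (E x * G x + 2 * m x) / (G x + 1) := by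
    have h := tC.sub (tbE.const_mul 2)
    filter_upwards [h.eventually (lt_mem_nhds (by norm_num : (0 : ℝ) < 1 - 2 * 0)), hE]
      with x hx hE
    rw [← mul_div_assoc, ← sub_div] at hx
    have := (div_pos_iff_of_pos_right hE).1 hx
    linarith
  have hex : ∀ᶠ x in l, ∃ y : ℝ × ℝ, (E x * G x + 2 * m x) / (G x + 1) ≤ y.1 ∧
      y.1 ≤ (E x * G x + 2 * m x) / (G x + 1) + b x ∧ 0 ≤ y.2 ∧ y.2 ≤ 1 ∧
      y.1 + (2 * (m x * b x) / (G x + 1)) / y.1 + y.2 * (1 - y.2) =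
        (E x * G x + 2 * m x) / (G x + 1) + b x ∧
      y.2 * (y.1 - (2 * (m x * b x) / (G x + 1)) / y.1) =
        y.1 - (E x * G x + 2 * m x) / (G x + 1) := by
    filter_upwards [hm, hG, hE, hb, hC] with x hm hG hE hb hC
    obtain ⟨q, p, h⟩ := exists_quadratic_factor (D := 2 * (m x * b x) / (G x + 1)) hb
      (by positivity) (by
        rw [← mul_div_assoc]
        refine div_le_div_of_nonneg_right ?_ (by positivity)
        have : 0 < b x * (E x * G x) := by positivity
        linarith) hC
    exact ⟨(q, p), h⟩
  obtain ⟨f, hf⟩ := Filter.skolem.1 hex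
  set q : ι → ℝ := fun x => (f x).1 with hq
  set p : ι → ℝ := fun x => (f x).2 with hp
  set s : ι → ℝ := fun x => (2 * (m x * b x) / (G x + 1)) / q x with hs
  have hq0 : ∀ᶠ x in l, 0 < q x := by
    filter_upwards [hf, hC, hb] with x hf hC hb
    have := hf.1
    simp only [hq]
    linarith
  have tq : Tendsto (fun x => q x / E x) l (𝓝 1) := by
    refine tendsto_of_tendsto_of_tendsto_of_le_of_le' tC (by simpa using tC.add tbE) ?_ ?_
    · filter_upwards [hf, hE] with x hf hE
      exact div_le_div_of_nonneg_right hf.1 hE.le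
    · filter_upwards [hf, hE] with x hf hE
      rw [← add_div]
      exact div_le_div_of_nonneg_right hf.2.1 hE.le
  have ts : Tendsto (fun x => s x / (2 * (m x * b x / (E x * G x)))) l (𝓝 1) := by
    have h : Tendsto (fun x => (1 + (G x)⁻¹)⁻¹ / (q x / E x)) l (𝓝 ((1 + 0)⁻¹ / 1)) :=
      ((tG.const_add 1).inv₀ (by norm_num)).div tq (by norm_num)
    norm_num at h
    refine h.congr' ?_
    filter_upwards [hG, hE, hm, hb, hq0] with x hG hE hm hb hq0
    simp only [hs]
    field_simp
  have tsb : Tendsto (fun x => s x / b x) l (𝓝 0) := by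
    have h := ts.mul (tm.const_mul 2)
    norm_num at h
    refine h.congr' ?_
    filter_upwards [hG, hE, hm, hb] with x hG hE hm hb
    field_simp
  have tsE : Tendsto (fun x => s x / E x) l (𝓝 0) := by
    have h := tsb.mul tbE
    norm_num at h
    refine h.congr' ?_
    filter_upwards [hE, hb] with x hE hb
    field_simp
  have tpp : Tendsto (fun x => p x * (1 - p x) / b x) l (𝓝 0) := by
    refine tendsto_of_tendsto_of_tendsto_of_le_of_le' tendsto_const_nhds tb ?_ ?_
    · filter_upwards [hf, hb] with x hf hb
      exact div_nonneg (mul_nonneg hf.2.2.1 (by linarith [hf.2.2.2.1])) hb.le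
    · filter_upwards [hf, hb] with x hf hb
      rw [inv_eq_one_div]
      refine div_le_div_of_nonneg_right ?_ hb.le
      have h1 := hf.2.2.1
      have h2 := hf.2.2.2.1
      simp only [hp]
      nlinarith
  have tp : Tendsto (fun x => p x / (b x / E x)) l (𝓝 1) := by
    have h : Tendsto (fun x => (1 - s x / b x - p x * (1 - p x) / b x) / (q x / E x - s x / E x)) l
        (𝓝 ((1 - 0 - 0) / (1 - 0))) :=
      ((tsb.const_sub 1).sub tpp).div (tq.sub tsE) (by norm_num)
    have hne := (tq.sub tsE).eventually (lt_mem_nhds (by norm_num : (0 : ℝ) < 1 - 0))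
    norm_num at h
    refine h.congr' ?_
    filter_upwards [hE, hb, hf, hne] with x hE hb hf hne
    have hqs : 0 < q x - s x := by
      rw [← sub_div] at hne
      exact (div_pos_iff_of_pos_right hE).1 hne
    have h1 : q x + s x + p x * (1 - p x) = (E x * G x + 2 * m x) / (G x + 1) + b x :=
      hf.2.2.2.2.1
    have h2 : p x * (q x - s x) = q x - (E x * G x + 2 * m x) / (G x + 1) := hf.2.2.2.2.2
    rw [← sub_div, div_eq_iff (by positivity)]
    field_simp
    linarith
  have tp0 : Tendsto p l (𝓝 0) := by
    have h := tp.mul tbE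
    norm_num at h
    refine h.congr' ?_
    filter_upwards [hE, hb] with x hE hb
    field_simp
  have tq' : Tendsto (fun x => (q x - p x ^ 2 / 4) / E x) l (𝓝 1) := by
    have h := tq.sub (((tp0.pow 2).div_const 4).mul tE)
    norm_num at h
    refine h.congr fun x => ?_
    rw [sub_div, div_eq_mul_inv (p x ^ 2 / 4)]
  have tW' : Tendsto (fun x => (2 * (m x * b x / (E x * G x)))⁻¹) l (𝓝 0) := by
    have h := tW.const_mul (1 / 2)
    norm_num at h
    refine h.congr fun x => ?_
    rw [mul_inv, inv_div]
    norm_num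
  have ts' : Tendsto
      (fun x => (s x - (1 - p x) ^ 2 / 4) / (2 * (m x * b x / (E x * G x)))) l (𝓝 1) := by
    have h := ts.sub ((((tp0.const_sub 1).pow 2).div_const 4).mul tW')
    norm_num at h
    refine h.congr fun x => ?_
    rw [sub_div, div_eq_mul_inv ((1 - p x) ^ 2 / 4), mul_inv 2, inv_div]
    ring
  refine ⟨q, p, s, ?_, tp0, tp, tq', ts'⟩
  filter_upwards [hf, hE, hG, hm, hb, hq0, tq'.eventually (lt_mem_nhds zero_lt_one),
    ts'.eventually (lt_mem_nhds zero_lt_one)] with x hf hE hG hm hb hq0 h4 h5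
  have h1 : q x + s x + p x * (1 - p x) = (E x * G x + 2 * m x) / (G x + 1) + b x :=
    hf.2.2.2.2.1
  have h2 : p x * (q x - s x) = q x - (E x * G x + 2 * m x) / (G x + 1) := hf.2.2.2.2.2
  refine ⟨h1, by linarith, mul_div_cancel₀ _ hq0.ne', ?_, ?_⟩
  · have := (div_pos_iff_of_pos_right hE).1 h4
    linarith
  · have := (div_pos_iff_of_pos_right (by positivity)).1 h5
    linarith

theorem charPoly_roots_T1 (α β γ : ℝ)
    (h1 : 1 / 2 < α) (h2 : α < (β + 1) / 2) (h3 : 0 < β) (h4 : β ≤ 1)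
    (h5 : 0 < γ) (h6 : γ < 2 * α - β) :
    ∃ M > (0 : ℝ), ∃ l1 l3 : ℝ → ℂ,
      (∀ μ > M,
        charPoly α β γ μ (l1 μ) = 0 ∧ charPoly α β γ μ ((starRingEnd ℂ) (l1 μ)) = 0 ∧
        charPoly α β γ μ (l3 μ) = 0 ∧ charPoly α β γ μ ((starRingEnd ℂ) (l3 μ)) = 0) ∧
      Tendsto (fun μ : ℝ => (l1 μ).re / (-(1 / 2) * μ ^ (-(2 * α) + β + γ))) atTop (𝓝 1) ∧
      Tendsto (fun μ : ℝ => (l1 μ).im / (μ ^ (α - γ / 2))) atTop (𝓝 1) ∧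
      Tendsto (fun μ : ℝ => (l3 μ).re / (-(1 / 2) : ℝ)) atTop (𝓝 1) ∧
      Tendsto (fun μ : ℝ => (l3 μ).im / (Real.sqrt 2 * μ ^ (-α + β / 2 + 1 / 2))) atTop (𝓝 1) := by
  have hpos : ∀ᶠ μ : ℝ in atTop, 0 < μ := eventually_gt_atTop 0
  have hrpos : ∀ e : ℝ, ∀ᶠ μ : ℝ in atTop, 0 < μ ^ e :=
    fun e => hpos.mono fun μ hμ => Real.rpow_pos_of_pos hμ e
  have hlim : ∀ e : ℝ, e < 0 → Tendsto (fun μ : ℝ => μ ^ e) atTop (𝓝 0) := fun e he => by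
    simpa using tendsto_rpow_neg_atTop (neg_pos.2 he)
  have hlim_inv : ∀ e : ℝ, 0 < e → Tendsto (fun μ : ℝ => (μ ^ e)⁻¹) atTop (𝓝 0) := fun e he =>
    tendsto_inv_atTop_zero.comp (tendsto_rpow_atTop he)
  have hE : ∀ μ : ℝ, 0 < μ → μ ^ (2 * α - γ) * μ ^ γ = μ ^ (2 * α) := fun μ hμ => by
    rw [← Real.rpow_add hμ]
    congr 1
    ring
  have hW : ∀ μ : ℝ, 0 < μ → μ * μ ^ β = μ ^ (1 + β) := fun μ hμ => by
    rw [Real.rpow_add hμ, Real.rpow_one]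
  obtain ⟨q, p, s, hev, tp0, tp, tq, ts⟩ := exists_quadratic_factor_asymptotics
    (m := fun μ : ℝ => μ) (G := fun μ => μ ^ γ) (E := fun μ => μ ^ (2 * α - γ))
    (b := fun μ => μ ^ β) hpos (hrpos _) (hrpos _) (hrpos _) (hlim_inv _ h5)
    (hlim_inv _ (by linarith)) (hlim_inv _ h3)
    ((hlim (1 - 2 * α) (by linarith)).congr' (hpos.mono fun μ hμ => by
      simp only
      rw [hE μ hμ, Real.rpow_sub hμ, Real.rpow_one]))
    ((hlim (β - (2 * α - γ)) (by linarith)).congr' (hpos.mono fun μ hμ =>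
      Real.rpow_sub hμ _ _))
    ((hlim (2 * α - (1 + β)) (by linarith)).congr' (hpos.mono fun μ hμ => by
      simp only
      rw [hE μ hμ, hW μ hμ, Real.rpow_sub hμ]))
  obtain ⟨M, hM⟩ := eventually_atTop.1 hev
  refine ⟨max M 1, by positivity, fun μ => ⟨-p μ / 2, √(q μ - p μ ^ 2 / 4)⟩,
    fun μ => ⟨-(1 - p μ) / 2, √(s μ - (1 - p μ) ^ 2 / 4)⟩, ?_, ?_, ?_, ?_, ?_⟩
  · intro μ hμ
    have hμ0 : 0 < μ := zero_lt_one.trans ((le_max_right M 1).trans_lt hμ)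
    obtain ⟨e2, e1, e0, hq, hs⟩ := hM μ ((le_max_left M 1).trans hμ.le)
    have hG : 0 < μ ^ γ := Real.rpow_pos_of_pos hμ0 γ
    have key := charPoly_eq_mul (α := α) (β := β) (γ := γ) (μ := μ) rfl
      (by rw [mul_div_cancel₀ _ (by positivity), hE μ hμ0])
      (by
        rw [mul_add, mul_div_cancel₀ _ (by positivity), hE μ hμ0, Real.rpow_add hμ0]
        ring)
      (by rw [mul_div_cancel₀ _ (by positivity), hW μ hμ0])
      (add_sub_cancel (p μ) 1) e2 e1 e0
    have conj_mk : ∀ x y : ℝ, starRingEnd ℂ ⟨x, y⟩ = ⟨x, -y⟩ := fun _ _ => rfl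
    refine ⟨?_, ?_, ?_, ?_⟩
    · rw [key, quadratic_root hq rfl]
      ring
    · rw [key, conj_mk, quadratic_root hq (neg_sq _)]
      ring
    · rw [key, quadratic_root hs rfl]
      ring
    · rw [key, conj_mk, quadratic_root hs (neg_sq _)]
      ring
  · refine tp.congr' (hpos.mono fun μ hμ => ?_)
    simp only
    rw [← Real.rpow_sub hμ, show -(2 * α) + β + γ = β - (2 * α - γ) by ring]
    have := Real.rpow_pos_of_pos hμ (β - (2 * α - γ))
    field_simp
  · have h := tq.sqrt
    rw [Real.sqrt_one] at h
    refine h.congr' (hpos.mono fun μ hμ => ?_)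
    simp only
    rw [Real.sqrt_div' _ (Real.rpow_nonneg hμ.le _), Real.sqrt_eq_rpow (μ ^ _),
      ← Real.rpow_mul hμ.le]
    congr 2
    ring
  · have h := tp0.const_sub 1
    rw [sub_zero] at h
    refine h.congr fun μ => ?_
    simp only
    ring
  · have h := ts.sqrt
    rw [Real.sqrt_one] at h
    refine h.congr' (hpos.mono fun μ hμ => ?_)
    simp only
    rw [hE μ hμ, hW μ hμ, ← Real.rpow_sub hμ, Real.sqrt_div' _ (by positivity),
      Real.sqrt_mul (by norm_num), Real.sqrt_eq_rpow (μ ^ _), ← Real.rpow_mul hμ.le]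
    congr 3
    ring
end

section
/- Assume 0 ≤ α < 1/2, 0 < β < 1, and 0 < γ < 1 − β (region T₂). Then there exist M > 0 and functions λ₁, λ₃ : ℝ → ℂ such that for every μ > M, λ₁(μ), its complex conjugate, λ₃(μ), and its complex conjugate are roots of f(·, μ), and as μ → ∞: Re λ₁(μ) = −(1/8)μ^(2α+β+γ−2)(1+o(1)), Im λ₁(μ) = √2 · μ^((1−γ)/2)(1+o(1)), Re λ₃(μ) = −(1/2)(1+o(1)), and Im λ₃(μ) = μ^(β/2)(1+o(1)). -/
open Filter Real Topology

open Polynomial in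
/-- A polynomial has a root near any point where it is small compared with its derivative. -/
lemma exists_root_norm_sub_le (p : ℂ[X]) (w : ℂ) (hw : p.derivative.eval w ≠ 0) :
    ∃ z, p.eval z = 0 ∧
      ‖z - w‖ ≤ (p.natDegree + 1) * (‖p.eval w‖ / ‖p.derivative.eval w‖) := by
  by_cases h0 : p.eval w = 0
  · exact ⟨w, h0, by simp [h0]⟩
  by_contra! hcon
  have hd : 0 < ‖p.derivative.eval w‖ := norm_pos_iff.2 hw
  have hp : 0 < ‖p.eval w‖ := norm_pos_iff.2 h0
  set K := ‖p.derivative.eval w‖ / ‖p.eval w‖ with hK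
  have hKpos : 0 < K := by positivity
  have hn : (0 : ℝ) < p.natDegree + 1 := by positivity
  have hterm : ∀ z ∈ p.roots, ‖1 / (w - z)‖ ≤ K / (p.natDegree + 1) := by
    intro z hz
    have hlt := hcon z (isRoot_of_mem_roots hz)
    rw [norm_div, norm_one, norm_sub_rev w z]
    have h : (p.natDegree + 1) * (‖p.eval w‖ / ‖p.derivative.eval w‖)
        = (K / (p.natDegree + 1))⁻¹ := by
      rw [hK]; field_simp
    rw [h] at hlt
    rw [one_div]
    exact inv_le_of_inv_le₀ (by positivity) hlt.le
  have hsum : K ≤ p.natDegree * (K / (p.natDegree + 1)) := by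
    calc K = ‖(p.roots.map fun z ↦ 1 / (w - z)).sum‖ := by
          rw [← (IsAlgClosed.splits p).eval_derivative_div_eval_of_ne_zero h0, norm_div]
      _ ≤ ((p.roots.map fun z ↦ 1 / (w - z)).map norm).sum := norm_multiset_sum_le _
      _ = (p.roots.map fun z ↦ ‖1 / (w - z)‖).sum := by rw [Multiset.map_map]; rfl
      _ ≤ (p.roots.map fun _ ↦ K / (p.natDegree + 1)).sum :=
          Multiset.sum_map_le_sum_map _ _ hterm
      _ = p.roots.card * (K / (p.natDegree + 1)) := by simp
      _ ≤ _ := by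
          gcongr
          exact p.card_roots'
  rw [mul_div_assoc', le_div_iff₀ hn] at hsum
  linarith

/-- Simple roots of a quartic depend continuously on the coefficients; the limiting polynomial
may have smaller degree. -/
lemma exists_tendsto_root {c₀ c₁ c₂ c₃ c₄ : ℝ → ℝ} {a₀ a₁ a₂ a₃ a₄ : ℝ} {w : ℂ}
    (h₀ : Tendsto c₀ atTop (𝓝 a₀)) (h₁ : Tendsto c₁ atTop (𝓝 a₁))
    (h₂ : Tendsto c₂ atTop (𝓝 a₂)) (h₃ : Tendsto c₃ atTop (𝓝 a₃))
    (h₄ : Tendsto c₄ atTop (𝓝 a₄))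
    (hw : a₄ * w ^ 4 + a₃ * w ^ 3 + a₂ * w ^ 2 + a₁ * w + a₀ = 0)
    (hw' : 4 * a₄ * w ^ 3 + 3 * a₃ * w ^ 2 + 2 * a₂ * w + a₁ ≠ 0) :
    ∃ z : ℝ → ℂ, (∀ᶠ μ in atTop, (c₄ μ : ℂ) * z μ ^ 4 + c₃ μ * z μ ^ 3 + c₂ μ * z μ ^ 2 +
      c₁ μ * z μ + c₀ μ = 0) ∧ Tendsto z atTop (𝓝 w) := by
  set F : ℝ → ℂ := fun μ ↦ (c₄ μ : ℂ) * w ^ 4 + c₃ μ * w ^ 3 + c₂ μ * w ^ 2 + c₁ μ * w + c₀ μ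
    with hF
  set G : ℝ → ℂ := fun μ ↦ 4 * (c₄ μ : ℂ) * w ^ 3 + 3 * c₃ μ * w ^ 2 + 2 * c₂ μ * w + c₁ μ
    with hG
  have hlim : ∀ {c : ℝ → ℝ} {a : ℝ}, Tendsto c atTop (𝓝 a) →
      Tendsto (fun μ ↦ (c μ : ℂ)) atTop (𝓝 (a : ℂ)) :=
    fun h ↦ (Complex.continuous_ofReal.tendsto _).comp h
  have hFlim : Tendsto F atTop (𝓝 0) := by
    rw [← hw]
    exact (((((hlim h₄).mul_const _).add ((hlim h₃).mul_const _)).add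
      ((hlim h₂).mul_const _)).add ((hlim h₁).mul_const _)).add (hlim h₀)
  have hGlim : Tendsto G atTop
      (𝓝 (4 * a₄ * w ^ 3 + 3 * a₃ * w ^ 2 + 2 * a₂ * w + a₁)) :=
    (((((hlim h₄).const_mul 4).mul_const _).add (((hlim h₃).const_mul 3).mul_const _)).add
      (((hlim h₂).const_mul 2).mul_const _)).add (hlim h₁)
  have hex : ∀ μ, ∃ z : ℂ, G μ ≠ 0 → ((c₄ μ : ℂ) * z ^ 4 + c₃ μ * z ^ 3 + c₂ μ * z ^ 2 +
      c₁ μ * z + c₀ μ = 0 ∧ ‖z - w‖ ≤ 5 * (‖F μ‖ / ‖G μ‖)) := by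
    intro μ
    by_cases hμ : G μ = 0
    · exact ⟨0, fun h ↦ absurd hμ h⟩
    let p : Polynomial ℂ := .C (c₄ μ : ℂ) * .X ^ 4 + .C (c₃ μ : ℂ) * .X ^ 3 +
      .C (c₂ μ : ℂ) * .X ^ 2 + .C (c₁ μ : ℂ) * .X + .C (c₀ μ : ℂ)
    have hpe (z : ℂ) : p.eval z = (c₄ μ : ℂ) * z ^ 4 + c₃ μ * z ^ 3 + c₂ μ * z ^ 2 +
      c₁ μ * z + c₀ μ := by simp [p]
    have hpd : p.derivative.eval w = G μ := by simp [p, hG]; ring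
    have hdeg : p.natDegree ≤ 4 := by simp only [p]; compute_degree
    obtain ⟨z, hz, hzw⟩ := exists_root_norm_sub_le p w (by rwa [hpd])
    refine ⟨z, fun _ ↦ ⟨by rw [← hpe, hz], hzw.trans ?_⟩⟩
    rw [hpd, hpe]
    have : (p.natDegree : ℝ) ≤ 4 := by exact_mod_cast hdeg
    gcongr
    linarith
  choose z hz using hex
  have hGne : ∀ᶠ μ in atTop, G μ ≠ 0 := hGlim.eventually_ne hw'
  refine ⟨z, hGne.mono fun μ h ↦ (hz μ h).1, ?_⟩
  rw [tendsto_iff_norm_sub_tendsto_zero]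
  refine squeeze_zero' (.of_forall fun μ ↦ norm_nonneg _) (hGne.mono fun μ h ↦ (hz μ h).2) ?_
  simpa using (hFlim.norm.div hGlim.norm (norm_ne_zero_iff.2 hw')).const_mul 5

/-- The substitution `l = s z` in the characteristic polynomial, normalized by `2 μ s²`. -/
lemma charPoly_ofReal_mul {α β γ μ s : ℝ} (hμ : 0 < μ) (hs : s ≠ 0) (z : ℂ) :
    charPoly α β γ μ (s * z) = ((2 * μ * s ^ 2 : ℝ) : ℂ) *
      ((((μ ^ γ + 1) * s ^ 2 / (2 * μ) : ℝ) : ℂ) * z ^ 4 +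
        (((μ ^ γ + 1) * s ^ 2 / (2 * μ) * s⁻¹ : ℝ) : ℂ) * z ^ 3 +
        (((μ ^ (2 * α - 1) + μ ^ (β + γ - 1) + 2 + μ ^ (β - 1)) / 2 : ℝ) : ℂ) * z ^ 2 +
        (((μ ^ (2 * α - 1) + 2) / 2 * s⁻¹ : ℝ) : ℂ) * z + ((μ ^ β / s ^ 2 : ℝ) : ℂ)) := by
  have hμ' : (μ : ℂ) ≠ 0 := by exact_mod_cast hμ.ne'
  have hs' : (s : ℂ) ≠ 0 := by exact_mod_cast hs
  rw [charPoly, rpow_sub_one hμ.ne', rpow_sub_one hμ.ne', rpow_sub_one hμ.ne',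
    rpow_add hμ 1 β, rpow_one]
  push_cast
  field_simp

lemma charPoly_conj (α β γ μ : ℝ) (l : ℂ) :
    charPoly α β γ μ ((starRingEnd ℂ) l) = (starRingEnd ℂ) (charPoly α β γ μ l) := by
  simp only [charPoly, map_add, map_mul, map_pow, Complex.conj_ofReal]

lemma tendsto_rpow_atTop_zero {y : ℝ} (hy : y < 0) :
    Tendsto (fun x : ℝ ↦ x ^ y) atTop (𝓝 0) := by
  simpa using tendsto_rpow_neg_atTop (neg_pos.2 hy)

/-- Existence of a root of the characteristic polynomial asymptotic to `i s(μ)`. -/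
lemma exists_charPoly_root {α β γ k₀ k₄ : ℝ} {s : ℝ → ℝ} (hα : α < 1 / 2) (hβ : β < 1)
    (hγ : γ < 1 - β) (hs : Tendsto s atTop atTop)
    (h₄ : Tendsto (fun μ ↦ (μ ^ γ + 1) * s μ ^ 2 / (2 * μ)) atTop (𝓝 k₄))
    (h₀ : Tendsto (fun μ ↦ μ ^ β / s μ ^ 2) atTop (𝓝 k₀))
    (hk : k₄ + k₀ = 1) (hk' : 2 * k₄ ≠ 1) :
    ∃ z : ℝ → ℂ, (∀ᶠ μ in atTop, charPoly α β γ μ (s μ * z μ) = 0) ∧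
      Tendsto z atTop (𝓝 Complex.I) := by
  have hA : Tendsto (fun μ : ℝ ↦ μ ^ (2 * α - 1)) atTop (𝓝 0) :=
    tendsto_rpow_atTop_zero (by linarith)
  have hBP : Tendsto (fun μ : ℝ ↦ μ ^ (β + γ - 1)) atTop (𝓝 0) :=
    tendsto_rpow_atTop_zero (by linarith)
  have hB : Tendsto (fun μ : ℝ ↦ μ ^ (β - 1)) atTop (𝓝 0) :=
    tendsto_rpow_atTop_zero (by linarith)
  have hs' := hs.inv_tendsto_atTop
  have h₁ := ((hA.add_const 2).div_const 2).mul hs'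
  have h₂ := (((hA.add hBP).add_const 2).add hB).div_const 2
  have h₃ := h₄.mul hs'
  obtain ⟨z, hz, hzlim⟩ := exists_tendsto_root (w := Complex.I) h₀ h₁ h₂ h₃ h₄
    (by
      have : (k₄ : ℂ) + k₀ = 1 := by exact_mod_cast hk
      rw [Complex.I_pow_four, Complex.I_sq]
      push_cast
      linear_combination this)
    (by
      intro h
      have h' := congrArg Complex.im h
      simp [pow_succ] at h'
      exact hk' (by linarith))
  refine ⟨z, ?_, hzlim⟩
  filter_upwards [hz, eventually_gt_atTop 0, hs.eventually_gt_atTop 0] with μ hμ hpos hsμ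
  rw [charPoly_ofReal_mul hpos hsμ.ne']
  exact mul_eq_zero_of_right _ hμ

/-- The characteristic polynomial written with its two dominant quadratic factors. -/
lemma charPoly_eq {α β γ μ : ℝ} (hμ : 0 < μ) (l : ℂ) :
    charPoly α β γ μ l =
      (((μ ^ γ + 1 : ℝ) : ℂ) * l ^ 2 + ((2 * μ : ℝ) : ℂ)) * (l ^ 2 + l + ((μ ^ β : ℝ) : ℂ)) +
        ((μ ^ (2 * α) : ℝ) : ℂ) * (l ^ 2 + l) := by
  rw [charPoly, rpow_add hμ, rpow_add hμ, rpow_one]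
  push_cast
  ring

/-- Imaginary part of the equation multiplied by the conjugate of `l² + l + B`. -/
lemma re_mul_eq_of_root_left {a m B C : ℝ} {l : ℂ} (hl : l.im ≠ 0)
    (h : ((a : ℂ) * l ^ 2 + ((2 * m : ℝ) : ℂ)) * (l ^ 2 + l + B) + C * (l ^ 2 + l) = 0) :
    l.re * (2 * (a * Complex.normSq (l ^ 2 + l + B) + C * B)) = -(C * B) := by
  have hr := congrArg Complex.re h
  have hi := congrArg Complex.im h
  simp [pow_two, Complex.normSq_apply] at hr hi ⊢
  refine mul_left_cancel₀ hl ?_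
  linear_combination (l.re * l.re - l.im * l.im + l.re + B) * hi -
    (l.re * l.im + l.im * l.re + l.im) * hr

/-- Imaginary part of the equation multiplied by the conjugate of `a l² + 2 m + C`. -/
lemma re_mul_eq_of_root_right {a m B C : ℝ} {l : ℂ} (hl : l.im ≠ 0)
    (h : ((a : ℂ) * l ^ 2 + ((2 * m : ℝ) : ℂ)) * (l ^ 2 + l + B) + C * (l ^ 2 + l) = 0) :
    l.re * (2 * (Complex.normSq (a * l ^ 2 + ((2 * m : ℝ) : ℂ) + C) + B * C * a)) =
      -Complex.normSq (a * l ^ 2 + ((2 * m : ℝ) : ℂ) + C) := by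
  have hr := congrArg Complex.re h
  have hi := congrArg Complex.im h
  simp [pow_two, Complex.normSq_apply] at hr hi ⊢
  refine mul_left_cancel₀ hl ?_
  linear_combination (a * (l.re * l.re - l.im * l.im) + 2 * m + C) * hi -
    (a * (l.re * l.im + l.im * l.re)) * hr

/-- Real part of a root asymptotic to `i √2 μ^((1-γ)/2)`. -/
lemma tendsto_re_of_root_left {α β γ : ℝ} {s : ℝ → ℝ} {z : ℝ → ℂ} (hα : α < 1 / 2) (hγ : 0 < γ)
    (hβγ : γ < 1 - β) (hs : Tendsto s atTop atTop)
    (hs2 : ∀ᶠ μ in atTop, s μ ^ 2 = 2 * μ ^ (1 - γ))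
    (hz : ∀ᶠ μ in atTop, charPoly α β γ μ (s μ * z μ) = 0) (hzI : Tendsto z atTop (𝓝 Complex.I)) :
    Tendsto (fun μ : ℝ ↦ (s μ * z μ : ℂ).re / (-(1 / 8) * μ ^ (2 * α + β + γ - 2)))
      atTop (𝓝 1) := by
  set q : ℝ → ℂ := fun μ ↦ z μ ^ 2 + ((s μ)⁻¹ : ℝ) * z μ + ((μ ^ (β + γ - 1) / 2 : ℝ) : ℂ)
    with hq
  have hqlim : Tendsto q atTop (𝓝 (-1)) := by
    have h := ((hzI.pow 2).add
      (((Complex.continuous_ofReal.tendsto _).comp hs.inv_tendsto_atTop).mul hzI)).add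
      ((Complex.continuous_ofReal.tendsto _).comp
        ((tendsto_rpow_atTop_zero (y := β + γ - 1) (by linarith)).div_const 2))
    simpa [hq] using h
  have hP : Tendsto (fun μ : ℝ ↦ 1 + μ ^ (-γ)) atTop (𝓝 1) := by
    simpa using (tendsto_rpow_neg_atTop hγ).const_add 1
  have hV := tendsto_rpow_atTop_zero (y := 2 * α + β + γ - 2) (by linarith)
  have hlim : Tendsto (fun μ : ℝ ↦ 4 / ((1 + μ ^ (-γ)) * 4 * Complex.normSq (q μ) +
      μ ^ (2 * α + β + γ - 2))) atTop (𝓝 1) := by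
    have h := (tendsto_const_nhds (x := (4 : ℝ))).div (((hP.mul_const 4).mul
      ((Complex.continuous_normSq.tendsto _).comp hqlim)).add hV) (by simp)
    simpa [Pi.div_def] using h
  refine hlim.congr' ?_
  have him : ∀ᶠ μ in atTop, (z μ).im ≠ 0 :=
    ((Complex.continuous_im.tendsto _).comp hzI).eventually_ne (by simp)
  filter_upwards [hz, him, hs2, eventually_gt_atTop 0, hs.eventually_gt_atTop 0]
    with μ hroot him hs2 hμ hsμ
  have key := re_mul_eq_of_root_left (by
    rw [Complex.im_ofReal_mul]; exact mul_ne_zero hsμ.ne' him)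
    (by rwa [charPoly_eq hμ] at hroot)
  have hs' : (s μ : ℂ) ≠ 0 := by exact_mod_cast hsμ.ne'
  have hB : μ ^ β = s μ ^ 2 * (μ ^ (β + γ - 1) / 2) := by
    rw [hs2, mul_assoc, mul_div_assoc', ← rpow_add hμ]
    ring_nf
  have hQ : (s μ * z μ : ℂ) ^ 2 + s μ * z μ + ((μ ^ β : ℝ) : ℂ) = ((s μ ^ 2 : ℝ) : ℂ) * q μ := by
    rw [hB, hq]
    push_cast
    field_simp
  have hW : (μ ^ γ + 1) * (s μ ^ 2 * s μ ^ 2) = μ ^ (2 - γ) * ((1 + μ ^ (-γ)) * 4) := by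
    rw [hs2, rpow_sub hμ, rpow_sub hμ, rpow_neg hμ.le, rpow_one, rpow_two]
    have := rpow_pos_of_pos hμ γ
    field_simp
    ring
  have hCB : μ ^ (2 * α) * μ ^ β = μ ^ (2 - γ) * μ ^ (2 * α + β + γ - 2) := by
    rw [← rpow_add hμ, ← rpow_add hμ]
    ring_nf
  rw [hQ, Complex.normSq_mul, Complex.normSq_ofReal, ← mul_assoc (μ ^ γ + 1), hW, hCB] at key
  have hT := rpow_pos_of_pos hμ (2 - γ)
  have hV := rpow_pos_of_pos hμ (2 * α + β + γ - 2)
  have hP := rpow_pos_of_pos hμ (-γ)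
  have hn := Complex.normSq_nonneg (q μ)
  have hkey := mul_left_cancel₀ hT.ne' (show μ ^ (2 - γ) * ((s μ * z μ : ℂ).re * (2 *
    ((1 + μ ^ (-γ)) * 4 * Complex.normSq (q μ) + μ ^ (2 * α + β + γ - 2)))) =
    μ ^ (2 - γ) * -μ ^ (2 * α + β + γ - 2) by linear_combination key)
  rw [div_eq_div_iff (by positivity) (by simpa using hV.ne')]
  linear_combination -(1 / 2) * hkey

/-- Real part of a root asymptotic to `i μ^(β/2)`. -/
lemma tendsto_re_of_root_right {α β γ : ℝ} {s : ℝ → ℝ} {z : ℝ → ℂ} (hα : α < 1 / 2) (hβ : β < 1)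
    (hβγ : γ < 1 - β) (hs : Tendsto s atTop atTop)
    (hs2 : ∀ᶠ μ in atTop, s μ ^ 2 = μ ^ β)
    (hz : ∀ᶠ μ in atTop, charPoly α β γ μ (s μ * z μ) = 0) (hzI : Tendsto z atTop (𝓝 Complex.I)) :
    Tendsto (fun μ : ℝ ↦ (s μ * z μ : ℂ).re / (-(1 / 2) : ℝ)) atTop (𝓝 1) := by
  set e : ℝ → ℂ := fun μ ↦ (((μ ^ (β + γ - 1) + μ ^ (β - 1)) / 2 : ℝ) : ℂ) * z μ ^ 2 +
    ((1 + μ ^ (2 * α - 1) / 2 : ℝ) : ℂ) with he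
  have hBP := tendsto_rpow_atTop_zero (y := β + γ - 1) (by linarith)
  have hB := tendsto_rpow_atTop_zero (y := β - 1) (by linarith)
  have hA := tendsto_rpow_atTop_zero (y := 2 * α - 1) (by linarith)
  have helim : Tendsto e atTop (𝓝 1) := by
    have h := (((Complex.continuous_ofReal.tendsto _).comp ((hBP.add hB).div_const 2)).mul
      (hzI.pow 2)).add
      ((Complex.continuous_ofReal.tendsto _).comp ((hA.div_const 2).const_add 1))
    simpa [he] using h
  set V : ℝ → ℝ := fun μ ↦ μ ^ (2 * α - 1) * ((μ ^ (β + γ - 1) + μ ^ (β - 1)) / 4) with hV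
  have hVlim : Tendsto V atTop (𝓝 0) := by
    simpa using hA.mul ((hBP.add hB).div_const 4)
  have hnlim := (Complex.continuous_normSq.tendsto _).comp helim
  have hlim : Tendsto (fun μ : ℝ ↦ Complex.normSq (e μ) / (Complex.normSq (e μ) + V μ))
      atTop (𝓝 1) := by
    simpa [Pi.div_def] using hnlim.div (hnlim.add hVlim) (by simp)
  refine hlim.congr' ?_
  have him : ∀ᶠ μ in atTop, (z μ).im ≠ 0 :=
    ((Complex.continuous_im.tendsto _).comp hzI).eventually_ne (by simp)
  filter_upwards [hz, him, hs2, eventually_gt_atTop 0, hs.eventually_gt_atTop 0]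
    with μ hroot him hs2 hμ hsμ
  have key := re_mul_eq_of_root_right (by
    rw [Complex.im_ofReal_mul]; exact mul_ne_zero hsμ.ne' him)
    (by rwa [charPoly_eq hμ] at hroot)
  have hs2' : (s μ : ℂ) ^ 2 = ((μ ^ β : ℝ) : ℂ) := by rw [← hs2]; push_cast; rfl
  have hμ' : (μ : ℂ) ≠ 0 := by exact_mod_cast hμ.ne'
  have hE : ((μ ^ γ + 1 : ℝ) : ℂ) * (s μ * z μ) ^ 2 + ((2 * μ : ℝ) : ℂ) +
      ((μ ^ (2 * α) : ℝ) : ℂ) = ((2 * μ : ℝ) : ℂ) * e μ := by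
    rw [mul_pow, hs2', he]
    simp only [rpow_sub_one hμ.ne', rpow_add hμ]
    push_cast
    field_simp
    ring
  have hBC : μ ^ β * μ ^ (2 * α) * (μ ^ γ + 1) = 2 * μ * (2 * μ) * V μ := by
    simp only [hV, rpow_sub_one hμ.ne', rpow_add hμ]
    field_simp
    ring
  rw [hE, Complex.normSq_mul, Complex.normSq_ofReal, hBC] at key
  have hn := Complex.normSq_nonneg (e μ)
  have hVpos : 0 < V μ := by
    have := rpow_pos_of_pos hμ (2 * α - 1)
    have := rpow_pos_of_pos hμ (β + γ - 1)
    have := rpow_pos_of_pos hμ (β - 1)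
    simp only [hV]
    positivity
  have hkey := mul_left_cancel₀ (by positivity : 2 * μ * (2 * μ) ≠ 0)
    (show 2 * μ * (2 * μ) * ((s μ * z μ : ℂ).re * (2 * (Complex.normSq (e μ) + V μ))) =
      2 * μ * (2 * μ) * -Complex.normSq (e μ) by linear_combination key)
  rw [div_eq_div_iff (by positivity) (by norm_num)]
  linear_combination -(1 / 2) * hkey

/-- Imaginary part of a root asymptotic to `i s(μ)`. -/
lemma tendsto_im_div {s : ℝ → ℝ} {z : ℝ → ℂ} (hs : Tendsto s atTop atTop)
    (hzI : Tendsto z atTop (𝓝 Complex.I)) :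
    Tendsto (fun μ : ℝ ↦ (s μ * z μ : ℂ).im / s μ) atTop (𝓝 1) := by
  have h : Tendsto (fun μ ↦ (z μ).im) atTop (𝓝 1) := (Complex.continuous_im.tendsto _).comp hzI
  refine h.congr' ?_
  filter_upwards [hs.eventually_gt_atTop 0] with μ hμ
  rw [Complex.im_ofReal_mul, mul_div_cancel_left₀ _ hμ.ne']

theorem charPoly_roots_T2 (α β γ : ℝ)
    (h1 : 0 ≤ α) (h2 : α < 1 / 2) (h3 : 0 < β) (h4 : β < 1)
    (h5 : 0 < γ) (h6 : γ < 1 - β) :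
    ∃ M > (0 : ℝ), ∃ l1 l3 : ℝ → ℂ,
      (∀ μ > M,
        charPoly α β γ μ (l1 μ) = 0 ∧ charPoly α β γ μ ((starRingEnd ℂ) (l1 μ)) = 0 ∧
        charPoly α β γ μ (l3 μ) = 0 ∧ charPoly α β γ μ ((starRingEnd ℂ) (l3 μ)) = 0) ∧
      Tendsto (fun μ : ℝ => (l1 μ).re / (-(1 / 8) * μ ^ (2 * α + β + γ - 2))) atTop (𝓝 1) ∧
      Tendsto (fun μ : ℝ => (l1 μ).im / (Real.sqrt 2 * μ ^ ((1 - γ) / 2))) atTop (𝓝 1) ∧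
      Tendsto (fun μ : ℝ => (l3 μ).re / (-(1 / 2) : ℝ)) atTop (𝓝 1) ∧
      Tendsto (fun μ : ℝ => (l3 μ).im / (μ ^ (β / 2))) atTop (𝓝 1) := by
  set s : ℝ → ℝ := fun μ ↦ √2 * μ ^ ((1 - γ) / 2) with hs_def
  set t : ℝ → ℝ := fun μ ↦ μ ^ (β / 2) with ht_def
  have hs : Tendsto s atTop atTop :=
    (tendsto_rpow_atTop (by linarith)).const_mul_atTop (by positivity)
  have ht : Tendsto t atTop atTop := tendsto_rpow_atTop (by linarith)
  have hs2 : ∀ᶠ μ in atTop, s μ ^ 2 = 2 * μ ^ (1 - γ) := by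
    filter_upwards [eventually_gt_atTop 0] with μ hμ
    rw [hs_def, mul_pow, sq_sqrt zero_le_two, ← rpow_mul_natCast hμ.le]
    push_cast
    rw [div_mul_cancel₀ _ two_ne_zero]
  have ht2 : ∀ᶠ μ in atTop, t μ ^ 2 = μ ^ β := by
    filter_upwards [eventually_gt_atTop 0] with μ hμ
    rw [ht_def, ← rpow_mul_natCast hμ.le]
    push_cast
    rw [div_mul_cancel₀ _ two_ne_zero]
  have hBP := tendsto_rpow_atTop_zero (y := β + γ - 1) (by linarith)
  have hB := tendsto_rpow_atTop_zero (y := β - 1) (by linarith)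
  have hP : Tendsto (fun μ : ℝ ↦ 1 + μ ^ (-γ)) atTop (𝓝 1) := by
    simpa using (tendsto_rpow_neg_atTop h5).const_add 1
  obtain ⟨z, hz, hzI⟩ := exists_charPoly_root (k₀ := 0) (k₄ := 1) h2 h4 h6 hs
    (by
      refine hP.congr' ?_
      filter_upwards [hs2, eventually_gt_atTop 0] with μ hs2 hμ
      have := rpow_pos_of_pos hμ γ
      rw [hs2, rpow_sub hμ, rpow_neg hμ.le, rpow_one]
      field_simp)
    (by
      refine (show Tendsto (fun μ : ℝ ↦ μ ^ (β + γ - 1) / 2) atTop (𝓝 0) by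
        simpa using hBP.div_const 2).congr' ?_
      filter_upwards [hs2, eventually_gt_atTop 0] with μ hs2 hμ
      have := rpow_pos_of_pos hμ γ
      rw [hs2, rpow_sub hμ 1, rpow_sub_one hμ.ne', rpow_add hμ, rpow_one]
      field_simp)
    (by norm_num) (by norm_num)
  obtain ⟨w, hw, hwI⟩ := exists_charPoly_root (k₀ := 1) (k₄ := 0) h2 h4 h6 ht
    (by
      refine (show Tendsto (fun μ : ℝ ↦ (μ ^ (β + γ - 1) + μ ^ (β - 1)) / 2) atTop (𝓝 0) by
        simpa using (hBP.add hB).div_const 2).congr' ?_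
      filter_upwards [ht2, eventually_gt_atTop 0] with μ ht2 hμ
      rw [ht2, rpow_sub_one hμ.ne', rpow_sub_one hμ.ne', rpow_add hμ]
      field_simp)
    (by
      refine tendsto_const_nhds.congr' ?_
      filter_upwards [ht2, eventually_gt_atTop 0] with μ ht2 hμ
      rw [ht2, div_self (rpow_pos_of_pos hμ β).ne'])
    (by norm_num) (by norm_num)
  obtain ⟨N, hN⟩ := eventually_atTop.1 (hz.and hw)
  refine ⟨max N 1, by positivity, fun μ ↦ s μ * z μ, fun μ ↦ t μ * w μ, fun μ hμ ↦ ?_,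
    tendsto_re_of_root_left h2 h5 h6 hs hs2 hz hzI, tendsto_im_div hs hzI,
    tendsto_re_of_root_right h2 h4 h6 ht ht2 hw hwI, tendsto_im_div ht hwI⟩
  obtain ⟨hz, hw⟩ := hN μ ((le_max_left _ _).trans hμ.le)
  exact ⟨hz, by rw [charPoly_conj, hz, map_zero], hw, by rw [charPoly_conj, hw, map_zero]⟩
end

section
/- Assume (β+1)/2 < α ≤ 1, 0 ≤ β < 1, and 0 < γ ≤ 1 (region T₄). Then there exist M > 0 and functions λ₁, λ₃, λ₄ : ℝ → ℂ such that for every μ > M, λ₁(μ), its complex conjugate, λ₃(μ), and λ₄(μ) are roots of f(·, μ), and as μ → ∞: Re λ₁(μ) = −(1/2)μ^(−2α+β+γ)(1+o(1)), Im λ₁(μ) = μ^(α−γ/2)(1+o(1)), λ₃(μ) = −2μ^(−2α+β+1)(1+o(1)), and λ₄(μ) = −1·(1+o(1)), with λ₃(μ) and λ₄(μ) real. -/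
open Filter Real Topology

/-- A quartic with equal leading coefficients and two distinct real roots splits off its
complementary quadratic factor. -/
theorem quartic_factor {P B C E x y r q : ℝ} (hxy : x ≠ y)
    (hx : P * x ^ 4 + P * x ^ 3 + B * x ^ 2 + C * x + E = 0)
    (hy : P * y ^ 4 + P * y ^ 3 + B * y ^ 2 + C * y + E = 0)
    (hr : r = 1 + x + y) (hq : P * q = B + P * ((x + y) * r - x * y)) :
    C = P * (x * y * r - (x + y) * q) ∧ E = P * (x * y * q) := by
  have hB : B = P * q - P * ((x + y) * r - x * y) := by linarith
  subst hr
  have hC : C = P * (x * y * (1 + x + y) - (x + y) * q) := by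
    apply mul_left_cancel₀ (sub_ne_zero.2 hxy)
    rw [hB] at hx hy
    linear_combination hx - hy
  refine ⟨hC, ?_⟩
  rw [hB, hC] at hx
  linear_combination hx

theorem quadratic_root_s4 {r q : ℝ} (z : ℂ)
    (hre : z.re = -r / 2) (him : z.im ^ 2 = q - r ^ 2 / 4) :
    z ^ 2 + r * z + q = 0 := by
  apply Complex.ext
  · simp [pow_two, hre]
    nlinarith
  · simp [pow_two, hre]
    ring

theorem tendsto_rpow_div_rpow_atTop {u v : ℝ} (h : u < v) :
    Tendsto (fun μ : ℝ => μ ^ u / μ ^ v) atTop (𝓝 0) := by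
  refine (tendsto_rpow_neg_atTop (sub_pos.2 h)).congr' ?_
  filter_upwards [eventually_gt_atTop 0] with μ hμ
  rw [← rpow_sub hμ]
  congr 1
  ring

theorem charPoly_ofReal (α β γ μ x : ℝ) :
    charPoly α β γ μ (x : ℂ) =
      (((μ ^ γ + 1) * x ^ 4 + (μ ^ γ + 1) * x ^ 3 +
        (μ ^ (2 * α) + μ ^ (β + γ) + 2 * μ + μ ^ β) * x ^ 2 +
        (μ ^ (2 * α) + 2 * μ) * x + 2 * μ ^ (1 + β) : ℝ) : ℂ) := by
  simp only [charPoly]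
  push_cast
  ring

/-- Two distinct real roots of a quartic which is positive at `-1` and `0` but negative
at `-1 / 2`. -/
theorem quartic_exists_roots {P B C E : ℝ} (h0 : 0 < E) (h1 : 0 < B - C + E)
    (h2 : -P / 16 + B / 4 - C / 2 + E < 0) :
    ∃ x y : ℝ, x ∈ Set.Ioo (-1 / 2 : ℝ) 0 ∧ y ∈ Set.Ioo (-1 : ℝ) (-1 / 2) ∧
      P * x ^ 4 + P * x ^ 3 + B * x ^ 2 + C * x + E = 0 ∧
      P * y ^ 4 + P * y ^ 3 + B * y ^ 2 + C * y + E = 0 := by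
  set g : ℝ → ℝ := fun x => P * x ^ 4 + P * x ^ 3 + B * x ^ 2 + C * x + E with hg
  have hc : Continuous g := by fun_prop
  obtain ⟨x, hx, hx'⟩ := intermediate_value_Ioo (by norm_num : (-1 / 2 : ℝ) ≤ 0) hc.continuousOn
    (show (0 : ℝ) ∈ Set.Ioo (g (-1 / 2)) (g 0) by constructor <;> simp only [hg] <;> linarith)
  obtain ⟨y, hy, hy'⟩ := intermediate_value_Ioo' (by norm_num : (-1 : ℝ) ≤ -1 / 2) hc.continuousOn
    (show (0 : ℝ) ∈ Set.Ioo (g (-1 / 2)) (g (-1)) by constructor <;> simp only [hg] <;> linarith)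
  exact ⟨x, y, hx, hy, hx', hy'⟩

theorem charPoly_roots_T4 (α β γ : ℝ)
    (h1 : (β + 1) / 2 < α) (h2 : α ≤ 1) (h3 : 0 ≤ β) (h4 : β < 1)
    (h5 : 0 < γ) (h6 : γ ≤ 1) :
    ∃ M > (0 : ℝ), ∃ l1 l3 l4 : ℝ → ℂ,
      (∀ μ > M,
        charPoly α β γ μ (l1 μ) = 0 ∧ charPoly α β γ μ ((starRingEnd ℂ) (l1 μ)) = 0 ∧
        charPoly α β γ μ (l3 μ) = 0 ∧ charPoly α β γ μ (l4 μ) = 0 ∧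
        (l3 μ).im = 0 ∧ (l4 μ).im = 0) ∧
      Tendsto (fun μ : ℝ => (l1 μ).re / (-(1 / 2) * μ ^ (-(2 * α) + β + γ))) atTop (𝓝 1) ∧
      Tendsto (fun μ : ℝ => (l1 μ).im / (μ ^ (α - γ / 2))) atTop (𝓝 1) ∧
      Tendsto (fun μ : ℝ => (l3 μ).re / (-2 * μ ^ (-(2 * α) + β + 1))) atTop (𝓝 1) ∧
      Tendsto (fun μ : ℝ => (l4 μ).re / (-1 : ℝ)) atTop (𝓝 1) := by
  set P : ℝ → ℝ := fun μ => μ ^ γ + 1 with hP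
  set a : ℝ → ℝ := fun μ => μ ^ (2 * α) with ha
  set B : ℝ → ℝ := fun μ => μ ^ (2 * α) + μ ^ (β + γ) + 2 * μ + μ ^ β with hB
  set C : ℝ → ℝ := fun μ => μ ^ (2 * α) + 2 * μ with hC
  set E : ℝ → ℝ := fun μ => 2 * μ ^ (1 + β) with hE
  have pos : ∀ μ > 0, 0 < a μ := fun μ hμ => rpow_pos_of_pos hμ _
  have one_div : Tendsto (fun μ : ℝ => 1 / a μ) atTop (𝓝 0) := by
    simpa using tendsto_rpow_div_rpow_atTop (show (0 : ℝ) < 2 * α by linarith)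
  have mu_div : Tendsto (fun μ : ℝ => μ / a μ) atTop (𝓝 0) := by
    simpa using tendsto_rpow_div_rpow_atTop (show (1 : ℝ) < 2 * α by linarith)
  have gamma_div := tendsto_rpow_div_rpow_atTop (show γ < 2 * α by linarith)
  have P_div : Tendsto (fun μ => P μ / a μ) atTop (𝓝 0) := by
    have := gamma_div.add one_div
    simpa [hP, add_div] using this
  have E_div : Tendsto (fun μ => E μ / a μ) atTop (𝓝 0) := by
    have := (tendsto_rpow_div_rpow_atTop (show 1 + β < 2 * α by linarith)).const_mul 2
    simpa [hE, mul_div_assoc] using this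
  have C_div : Tendsto (fun μ => C μ / a μ) atTop (𝓝 1) := by
    have := (mu_div.const_mul 2).const_add 1
    rw [mul_zero, add_zero] at this
    refine this.congr' ?_
    filter_upwards [eventually_gt_atTop 0] with μ hμ
    have := pos μ hμ
    rw [show C μ = a μ + 2 * μ from rfl, add_div, div_self this.ne', mul_div_assoc]
  have B_div : Tendsto (fun μ => B μ / a μ) atTop (𝓝 1) := by
    have := (C_div.add (tendsto_rpow_div_rpow_atTop (show β + γ < 2 * α by linarith))).add
      (tendsto_rpow_div_rpow_atTop (show β < 2 * α by linarith))
    rw [add_zero, add_zero] at this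
    refine this.congr fun μ => ?_
    simp only [hB, hC, ha]
    ring
  have hBC : ∀ μ > 0, B μ - C μ = P μ * μ ^ β := by
    intro μ hμ
    simp only [hB, hC, hP, rpow_add hμ]
    ring
  have half_neg : ∀ᶠ μ in atTop, -P μ / 16 + B μ / 4 - C μ / 2 + E μ < 0 := by
    have key : Tendsto (fun μ => -(P μ / a μ) / 16 + (B μ / a μ) / 4 - (C μ / a μ) / 2 + E μ / a μ)
        atTop (𝓝 (-0 / 16 + 1 / 4 - 1 / 2 + 0)) :=
      (((P_div.neg.div_const 16).add (B_div.div_const 4)).sub (C_div.div_const 2)).add E_div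
    filter_upwards [key.eventually_lt_const (show _ < (0 : ℝ) by norm_num),
      eventually_gt_atTop 0] with μ h hμ
    have := pos μ hμ
    have e : -P μ / 16 + B μ / 4 - C μ / 2 + E μ =
        a μ * (-(P μ / a μ) / 16 + (B μ / a μ) / 4 - (C μ / a μ) / 2 + E μ / a μ) := by
      field_simp
    rw [e]
    exact mul_neg_of_pos_of_neg this h
  have hex : ∀ᶠ μ in atTop, ∃ x y : ℝ, x ∈ Set.Ioo (-1 / 2 : ℝ) 0 ∧ y ∈ Set.Ioo (-1 : ℝ) (-1 / 2) ∧
      P μ * x ^ 4 + P μ * x ^ 3 + B μ * x ^ 2 + C μ * x + E μ = 0 ∧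
      P μ * y ^ 4 + P μ * y ^ 3 + B μ * y ^ 2 + C μ * y + E μ = 0 := by
    filter_upwards [half_neg, eventually_gt_atTop 0] with μ h hμ
    have hEpos : 0 < E μ := by simp only [hE]; positivity
    refine quartic_exists_roots hEpos ?_ h
    rw [hBC μ hμ]
    have : 0 < P μ * μ ^ β := by simp only [hP]; positivity
    linarith
  obtain ⟨x, hx⟩ := hex.choice
  obtain ⟨y, hxy⟩ := hx.choice
  clear hx hex half_neg
  -- `t (t + 1)` tends to zero along either root `t`
  have small : ∀ t : ℝ → ℝ, (∀ᶠ μ in atTop, |t μ| ≤ 1) →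
      (∀ᶠ μ in atTop, P μ * t μ ^ 4 + P μ * t μ ^ 3 + B μ * t μ ^ 2 + C μ * t μ + E μ = 0) →
      Tendsto (fun μ => t μ * (t μ + 1)) atTop (𝓝 0) := by
    intro t ht hroot
    have key : Tendsto (fun μ => P μ / a μ * 2 + |B μ / a μ - 1| + |C μ / a μ - 1| + |E μ / a μ|)
        atTop (𝓝 (0 * 2 + |1 - 1| + |1 - 1| + |0|)) :=
      (((P_div.mul_const 2).add (B_div.sub_const 1).abs).add (C_div.sub_const 1).abs).add E_div.abs
    simp only [sub_self, abs_zero, zero_mul, add_zero] at key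
    refine squeeze_zero_norm' ?_ key
    filter_upwards [ht, hroot, eventually_gt_atTop 0] with μ ht hr hμ
    have hap := pos μ hμ
    have hPp : 0 ≤ P μ / a μ := by simp only [hP]; positivity
    have e : t μ * (t μ + 1) = -(P μ / a μ * (t μ ^ 4 + t μ ^ 3) + (B μ / a μ - 1) * t μ ^ 2
        + (C μ / a μ - 1) * t μ + E μ / a μ) := by
      field_simp
      linear_combination hr
    have p2 : |t μ ^ 2| ≤ 1 := by rw [abs_pow]; exact pow_le_one₀ (abs_nonneg _) ht
    have p34 : |t μ ^ 4 + t μ ^ 3| ≤ 2 := by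
      refine (abs_add_le _ _).trans ?_
      rw [abs_pow, abs_pow]
      linarith [pow_le_one₀ (n := 4) (abs_nonneg _) ht, pow_le_one₀ (n := 3) (abs_nonneg _) ht]
    rw [norm_eq_abs, e, abs_neg]
    refine (abs_add_le _ _).trans (add_le_add_left ((abs_add_le _ _).trans
      (add_le_add ((abs_add_le _ _).trans (add_le_add ?_ ?_)) ?_)) _)
    · rw [abs_mul, abs_of_nonneg hPp]
      gcongr
    · rw [abs_mul]
      exact mul_le_of_le_one_right (abs_nonneg _) p2
    · rw [abs_mul]
      exact mul_le_of_le_one_right (abs_nonneg _) ht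
  have x_lim : Tendsto x atTop (𝓝 0) := by
    have := (small x (by
      filter_upwards [hxy] with μ h
      exact abs_le.2 ⟨by linarith [h.1.1], by linarith [h.1.2]⟩)
      (by filter_upwards [hxy] with μ h using h.2.2.1)).abs.mul_const 2
    rw [abs_zero, zero_mul] at this
    refine squeeze_zero_norm' ?_ this
    filter_upwards [hxy] with μ h
    rw [norm_eq_abs, abs_mul, mul_assoc, abs_of_pos (show 0 < x μ + 1 by linarith [h.1.1])]
    exact le_mul_of_one_le_right (abs_nonneg _) (by linarith [h.1.1])
  have y_lim : Tendsto y atTop (𝓝 (-1)) := by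
    have := (small y (by
      filter_upwards [hxy] with μ h
      exact abs_le.2 ⟨by linarith [h.2.1.1], by linarith [h.2.1.2]⟩)
      (by filter_upwards [hxy] with μ h using h.2.2.2)).abs.mul_const 2
    rw [abs_zero, zero_mul] at this
    rw [tendsto_iff_norm_sub_tendsto_zero]
    refine squeeze_zero' (Eventually.of_forall fun _ => norm_nonneg _) ?_ this
    filter_upwards [hxy] with μ h
    rw [norm_eq_abs, abs_mul, sub_neg_eq_add, mul_comm |y μ|, mul_assoc,
      abs_of_neg (show y μ < 0 by linarith [h.2.1.2])]
    exact le_mul_of_one_le_right (abs_nonneg _) (by linarith [h.2.1.2])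
  set r : ℝ → ℝ := fun μ => 1 + x μ + y μ with hr
  set q : ℝ → ℝ := fun μ => B μ / P μ + ((x μ + y μ) * r μ - x μ * y μ) with hq
  have r_lim : Tendsto r atTop (𝓝 0) := by
    simpa using (x_lim.const_add 1).add y_lim
  have xy_lim : Tendsto (fun μ => x μ * y μ) atTop (𝓝 0) := by
    simpa using x_lim.mul y_lim
  have P_pos : ∀ μ > 0, 0 < P μ := fun μ hμ => by simp only [hP]; positivity
  -- the quadratic factor has constant coefficient equivalent to `μ ^ (2 * α - γ)`
  have q_lim : Tendsto (fun μ => q μ * (μ ^ γ / a μ)) atTop (𝓝 1) := by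
    have hγ : Tendsto (fun μ : ℝ => μ ^ γ / P μ) atTop (𝓝 1) := by
      have := (tendsto_rpow_neg_atTop h5).const_add 1
      rw [add_zero] at this
      have := this.inv₀ one_ne_zero
      rw [inv_one] at this
      refine this.congr' ?_
      filter_upwards [eventually_gt_atTop 0] with μ hμ
      have := rpow_pos_of_pos hμ γ
      simp only [hP]
      rw [rpow_neg hμ.le]
      field_simp
    have := (B_div.mul hγ).add
      ((((x_lim.add y_lim).mul r_lim).sub xy_lim).mul gamma_div)
    norm_num at this
    refine this.congr' ?_
    filter_upwards [eventually_gt_atTop 0] with μ hμ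
    have := pos μ hμ
    have := P_pos μ hμ
    simp only [hq, ha]
    ring
  have disc_lim : Tendsto (fun μ => (q μ - r μ ^ 2 / 4) * (μ ^ γ / a μ)) atTop (𝓝 1) := by
    have := q_lim.sub (((r_lim.pow 2).div_const 4).mul gamma_div)
    norm_num at this
    refine this.congr fun μ => ?_
    simp only [ha]
    ring
  have disc_pos : ∀ᶠ μ in atTop, 0 < q μ - r μ ^ 2 / 4 := by
    filter_upwards [disc_lim.eventually_const_lt zero_lt_one, eventually_gt_atTop 0] with μ h hμ
    have := pos μ hμ
    exact pos_of_mul_pos_left h (by positivity)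
  have factor : ∀ᶠ μ in atTop,
      C μ = P μ * (x μ * y μ * r μ - (x μ + y μ) * q μ) ∧ E μ = P μ * (x μ * y μ * q μ) := by
    filter_upwards [hxy, eventually_gt_atTop 0] with μ h hμ
    have := (P_pos μ hμ).ne'
    refine quartic_factor (by linarith [h.1.1, h.2.1.2] : y μ < x μ).ne' h.2.2.1 h.2.2.2 rfl ?_
    simp only [hq]
    field_simp
  have r_eq : ∀ᶠ μ in atTop, r μ * (q μ + 1 - r μ) = μ ^ β - x μ * y μ * (1 - r μ) := by
    filter_upwards [factor, eventually_gt_atTop 0] with μ h hμ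
    have hp := (P_pos μ hμ).ne'
    apply mul_left_cancel₀ hp
    have e1 : P μ * q μ = B μ + P μ * ((x μ + y μ) * r μ - x μ * y μ) := by
      simp only [hq]
      field_simp
    have e2 : x μ + y μ = r μ - 1 := by simp only [hr]; ring
    rw [e2] at e1 h
    linear_combination e1 + h.1 + hBC μ hμ
  set l1 : ℝ → ℂ := fun μ => ⟨-r μ / 2, √(q μ - r μ ^ 2 / 4)⟩ with hl1
  have roots : ∀ᶠ μ in atTop,
        charPoly α β γ μ (l1 μ) = 0 ∧ charPoly α β γ μ ((starRingEnd ℂ) (l1 μ)) = 0 ∧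
        charPoly α β γ μ (x μ) = 0 ∧ charPoly α β γ μ (y μ) = 0 := by
    filter_upwards [hxy, disc_pos, factor, eventually_gt_atTop 0] with μ h hd hf hμ
    have hp := (P_pos μ hμ).ne'
    have e1 : B μ = P μ * (q μ - ((x μ + y μ) * r μ - x μ * y μ)) := by
      simp only [hq]
      field_simp
      ring
    have hfac : ∀ z : ℂ, z ^ 2 + r μ * z + q μ = 0 → charPoly α β γ μ z = 0 := by
      intro z hz
      have : charPoly α β γ μ z = (P μ : ℂ) * z ^ 4 + (P μ : ℂ) * z ^ 3 + (B μ : ℂ) * z ^ 2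
        + (C μ : ℂ) * z + (E μ : ℂ) := rfl
      rw [this, e1, hf.1, hf.2]
      have e2 : (r μ : ℂ) = 1 + x μ + y μ := by simp only [hr]; push_cast; ring
      push_cast
      rw [e2] at hz ⊢
      linear_combination (P μ : ℂ) * (z - x μ) * (z - y μ) * hz
    refine ⟨hfac _ (quadratic_root_s4 _ rfl (sq_sqrt hd.le)),
      hfac _ (quadratic_root_s4 _ rfl ?_), ?_, ?_⟩
    · simp [hl1, sq_sqrt hd.le]
    · rw [charPoly_ofReal]
      exact_mod_cast h.2.2.1
    · rw [charPoly_ofReal]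
      exact_mod_cast h.2.2.2
  obtain ⟨M, hM⟩ := eventually_atTop.1 roots
  refine ⟨max M 1, by positivity, l1, fun μ => x μ, fun μ => y μ, fun μ hμ => ?_, ?_, ?_, ?_, ?_⟩
  · obtain ⟨c1, c2, c3, c4⟩ := hM μ ((le_max_left _ _).trans hμ.le)
    exact ⟨c1, c2, c3, c4, Complex.ofReal_im _, Complex.ofReal_im _⟩
  · have num : Tendsto (fun μ => 1 - x μ * y μ * (1 - r μ) / μ ^ β) atTop (𝓝 1) := by
      have : Tendsto (fun μ => x μ * y μ * (1 - r μ) / μ ^ β) atTop (𝓝 0) := by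
        have h0 : Tendsto (fun μ => |x μ * y μ * (1 - r μ)|) atTop (𝓝 0) := by
          simpa using (xy_lim.mul (r_lim.const_sub 1)).abs
        refine squeeze_zero_norm' ?_ h0
        filter_upwards [eventually_ge_atTop 1] with μ hμ
        rw [norm_div, norm_eq_abs, norm_eq_abs]
        exact div_le_self (abs_nonneg _) ((one_le_rpow hμ h3).trans (le_abs_self _))
      simpa using this.const_sub 1
    have den : Tendsto (fun μ => q μ * (μ ^ γ / a μ) + (1 - r μ) * (μ ^ γ / a μ))
        atTop (𝓝 1) := by
      simpa using q_lim.add ((r_lim.const_sub 1).mul gamma_div)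
    have := num.div den one_ne_zero
    rw [div_one] at this
    refine this.congr' ?_
    filter_upwards [r_eq, eventually_gt_atTop 0, den.eventually_ne one_ne_zero] with μ h hμ hden
    have hap := pos μ hμ
    have hβ := rpow_pos_of_pos hμ β
    have hγ := rpow_pos_of_pos hμ γ
    have hexp : μ ^ (-(2 * α) + β + γ) = μ ^ β * μ ^ γ / a μ := by
      rw [rpow_add hμ, rpow_add hμ, rpow_neg hμ.le]
      simp only [ha]
      field_simp
    simp only [Pi.div_apply, hl1]
    rw [hexp, div_eq_iff hden]
    field_simp
    linear_combination -h
  · have := disc_lim.sqrt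
    rw [sqrt_one] at this
    refine this.congr' ?_
    filter_upwards [disc_pos, eventually_gt_atTop 0] with μ h hμ
    have hs : √(a μ / μ ^ γ) = μ ^ (α - γ / 2) := by
      rw [sqrt_eq_rpow, ← rpow_sub hμ, ← rpow_mul hμ.le]
      congr 1
      ring
    simp only [hl1]
    rw [← hs, sqrt_mul h.le, ← inv_div (a μ), sqrt_inv, ← div_eq_mul_inv]
  · have den : Tendsto (fun μ => C μ / a μ + B μ / a μ * x μ + P μ / a μ * (x μ ^ 3 + x μ ^ 2))
        atTop (𝓝 1) := by
      simpa using (C_div.add (B_div.mul x_lim)).add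
        (P_div.mul ((x_lim.pow 3).add (x_lim.pow 2)))
    have := den.inv₀ one_ne_zero
    rw [inv_one] at this
    refine this.congr' ?_
    filter_upwards [hxy, eventually_gt_atTop 0, den.eventually_ne one_ne_zero] with μ h hμ hden
    have hap := pos μ hμ
    have hE0 : 0 < E μ := by simp only [hE]; positivity
    have hexp : -2 * μ ^ (-(2 * α) + β + 1) = -E μ / a μ := by
      rw [show -(2 * α) + β + 1 = (1 + β) - 2 * α by ring, rpow_sub hμ]
      simp only [hE, ha]
      ring
    rw [Complex.ofReal_re, hexp, inv_eq_iff_eq_inv, inv_div]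
    have hx0 := h.1.2.ne
    field_simp
    linear_combination h.2.2.1
  · simpa using y_lim.div_const (-1)
end

section
/- Assume α = (β+γ)/2, 1 − γ < β ≤ 1, and 0 < γ < 1 (region F₁₃). Then there exist M > 0 and functions λ₁, λ₃ : ℝ → ℂ such that for every μ > M, λ₁(μ), its complex conjugate, λ₃(μ), and its complex conjugate are roots of f(·, μ), and as μ → ∞: Re λ₁(μ) = −(1/4)(1+o(1)), Im λ₁(μ) = √2 · μ^(β/2)(1+o(1)), Re λ₃(μ) = −(1/4)(1+o(1)), and Im λ₃(μ) = μ^((1−γ)/2)(1+o(1)). In particular, the real parts of all four roots stay bounded away from 0, consistent with exponential stability on F₁₃. -/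
open Filter Real Topology

/-- A real monic quartic `z⁴ + z³ + A z² + B z + C` with `A` dominant factors as
`(z² + (1 - r) z + q) (z² + r z + s)` with `r ∈ [0, 1]` and `s ≤ q`. -/
theorem exists_quartic_factorization {A B C : ℝ} (hA : 1 ≤ A)
    (hdisc : 4 * C ≤ (A - 1) ^ 2) (hB : B ^ 2 + C ≤ A * B) :
    ∃ r q s : ℝ, 0 ≤ r ∧ r ≤ 1 ∧ s ≤ q ∧ q + s + (1 - r) * r = A ∧
      (1 - r) * s + r * q = B ∧ q * s = C := by
  let T : ℝ → ℝ := fun r => A - (1 - r) * r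
  let R : ℝ → ℝ := fun r => √(T r ^ 2 - 4 * C)
  let G : ℝ → ℝ := fun r => (1 - r) * ((T r - R r) / 2) + r * ((T r + R r) / 2)
  have hG : ContinuousOn G (Set.Icc 0 1) := by
    have : Continuous G := by fun_prop
    exact this.continuousOn
  have habs : |2 * B - A| ≤ √(A ^ 2 - 4 * C) := Real.abs_le_sqrt (by nlinarith)
  obtain ⟨hlo, hhi⟩ := abs_le.mp habs
  have hmem : B ∈ Set.Icc (G 0) (G 1) := by
    constructor <;> simp only [G, R, T] <;> norm_num <;> linarith
  obtain ⟨r, ⟨hr0, hr1⟩, hr⟩ := intermediate_value_Icc zero_le_one hG hmem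
  have hT : A - 1 ≤ T r := by simp only [T]; nlinarith
  have hsq : R r ^ 2 = T r ^ 2 - 4 * C := Real.sq_sqrt (by nlinarith)
  refine ⟨r, (T r + R r) / 2, (T r - R r) / 2, hr0, hr1, ?_, ?_, hr, ?_⟩
  · have : 0 ≤ R r := Real.sqrt_nonneg _
    linarith
  · simp only [T]; ring
  · linear_combination -hsq / 4

/-- Asymptotics of the quadratic factors of `z⁴ + z³ + A z² + B z + C` when
`A ~ a x`, `B ~ b x`, `C ~ c x y` with `0 < b < a`, `0 < c` and `y = o(x)`. -/
theorem exists_quartic_factorization_tendsto {ι : Type*} {l : Filter ι} {x y A B C : ι → ℝ}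
    {a b c : ℝ} (hb : 0 < b) (hba : b < a) (hc : 0 < c)
    (hx : Tendsto x l atTop) (hy : Tendsto y l atTop)
    (hyx : Tendsto (fun t => y t / x t) l (𝓝 0))
    (hA : Tendsto (fun t => A t / x t) l (𝓝 a))
    (hB : Tendsto (fun t => B t / x t) l (𝓝 b))
    (hC : Tendsto (fun t => C t / (x t * y t)) l (𝓝 c)) :
    ∃ r q s : ι → ℝ,
      (∀ᶠ t in l, q t + s t + (1 - r t) * r t = A t ∧
        (1 - r t) * s t + r t * q t = B t ∧ q t * s t = C t) ∧
      Tendsto r l (𝓝 (b / a)) ∧ Tendsto (fun t => q t / x t) l (𝓝 a) ∧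
      Tendsto (fun t => s t / y t) l (𝓝 (c / a)) := by
  have ha : 0 < a := hb.trans hba
  have hx0 : ∀ᶠ t in l, 0 < x t := hx.eventually_gt_atTop 0
  have hy0 : ∀ᶠ t in l, 0 < y t := hy.eventually_gt_atTop 0
  have hxi : Tendsto (fun t => 1 / x t) l (𝓝 0) := by
    simp only [one_div]
    exact hx.inv_tendsto_atTop
  have hCx : Tendsto (fun t => C t / x t ^ 2) l (𝓝 0) := by
    have h := hC.mul hyx
    rw [mul_zero] at h
    refine h.congr' ?_
    filter_upwards [hx0, hy0] with t h1 h2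
    field_simp
  have hA1 : Tendsto (fun t => (A t - 1) / x t) l (𝓝 a) := by
    simpa only [sub_div, sub_zero] using hA.sub hxi
  have hAgt : ∀ᶠ t in l, 1 < A t := by
    filter_upwards [hx0, hA1.eventually_const_lt ha] with t h1 h2
    have := (div_pos_iff_of_pos_right h1).mp h2
    linarith
  have hCpos : ∀ᶠ t in l, 0 < C t := by
    filter_upwards [hx0, hy0, hC.eventually_const_lt hc] with t h1 h2 h3
    exact (div_pos_iff_of_pos_right (mul_pos h1 h2)).mp h3
  have hdisc : ∀ᶠ t in l, 4 * C t ≤ (A t - 1) ^ 2 := by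
    have h : Tendsto (fun t => ((A t - 1) / x t) ^ 2 - 4 * (C t / x t ^ 2)) l
        (𝓝 (a ^ 2 - 4 * 0)) := (hA1.pow 2).sub (hCx.const_mul 4)
    filter_upwards [hx0, h.eventually_const_lt (show 0 < a ^ 2 - 4 * 0 by nlinarith)]
      with t h1 h2
    have h3 : ((A t - 1) / x t) ^ 2 - 4 * (C t / x t ^ 2)
        = ((A t - 1) ^ 2 - 4 * C t) / x t ^ 2 := by ring
    rw [h3] at h2
    have := (div_pos_iff_of_pos_right (pow_pos h1 2)).mp h2
    linarith
  have hBcond : ∀ᶠ t in l, B t ^ 2 + C t ≤ A t * B t := by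
    have h : Tendsto (fun t => A t / x t * (B t / x t) - (B t / x t) ^ 2 - C t / x t ^ 2) l
        (𝓝 (a * b - b ^ 2 - 0)) := ((hA.mul hB).sub (hB.pow 2)).sub hCx
    filter_upwards [hx0, h.eventually_const_lt (show 0 < a * b - b ^ 2 - 0 by nlinarith)]
      with t h1 h2
    have h3 : A t / x t * (B t / x t) - (B t / x t) ^ 2 - C t / x t ^ 2
        = (A t * B t - B t ^ 2 - C t) / x t ^ 2 := by ring
    rw [h3] at h2
    have := (div_pos_iff_of_pos_right (pow_pos h1 2)).mp h2
    linarith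
  have hex : ∀ t, ∃ r q s : ℝ,
      (1 < A t ∧ 4 * C t ≤ (A t - 1) ^ 2 ∧ B t ^ 2 + C t ≤ A t * B t) →
      0 ≤ r ∧ r ≤ 1 ∧ s ≤ q ∧ q + s + (1 - r) * r = A t ∧
      (1 - r) * s + r * q = B t ∧ q * s = C t := by
    intro t
    by_cases h : 1 < A t ∧ 4 * C t ≤ (A t - 1) ^ 2 ∧ B t ^ 2 + C t ≤ A t * B t
    · obtain ⟨r, q, s, h'⟩ := exists_quartic_factorization h.1.le h.2.1 h.2.2
      exact ⟨r, q, s, fun _ => h'⟩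
    · exact ⟨0, 0, 0, fun h' => absurd h' h⟩
  choose r q s hrqs using hex
  have hspec : ∀ᶠ t in l, 0 ≤ r t ∧ r t ≤ 1 ∧ s t ≤ q t ∧ q t + s t + (1 - r t) * r t = A t ∧
      (1 - r t) * s t + r t * q t = B t ∧ q t * s t = C t := by
    filter_upwards [hAgt, hdisc, hBcond] with t h1 h2 h3 using hrqs t ⟨h1, h2, h3⟩
  have hqlow : ∀ᶠ t in l, (A t - 1) / 2 ≤ q t := by
    filter_upwards [hspec] with t ⟨h1, h2, h3, h4, _⟩
    nlinarith
  have hsx : Tendsto (fun t => s t / x t) l (𝓝 0) := by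
    have hup : Tendsto (fun t => 2 * (C t / x t ^ 2) / ((A t - 1) / x t)) l (𝓝 0) := by
      have := (hCx.const_mul 2).div hA1 ha.ne'
      rw [mul_zero, zero_div] at this
      exact this
    refine tendsto_of_tendsto_of_tendsto_of_le_of_le' tendsto_const_nhds hup ?_ ?_
    · filter_upwards [hx0, hspec, hqlow, hAgt, hCpos] with t h1 h2 h3 h4 h5
      have hq : 0 < q t := by linarith
      have hs : 0 < s t := by
        rw [← h2.2.2.2.2.2] at h5
        exact (pos_iff_pos_of_mul_pos h5).mp hq
      positivity
    · filter_upwards [hx0, hspec, hqlow, hAgt, hCpos] with t h1 h2 h3 h4 h5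
      have hq : 0 < q t := by linarith
      have hA' : 0 < A t - 1 := by linarith
      have hs : 0 < s t := by
        rw [← h2.2.2.2.2.2] at h5
        exact (pos_iff_pos_of_mul_pos h5).mp hq
      have h6 : 2 * (C t / x t ^ 2) / ((A t - 1) / x t) = (2 * C t / (A t - 1)) / x t := by
        field_simp
      rw [h6]
      gcongr
      rw [le_div_iff₀ hA', ← h2.2.2.2.2.2]
      nlinarith
  have hmul : ∀ u : ι → ℝ, (∀ᶠ t in l, 0 ≤ u t ∧ u t ≤ 1) →
      ∀ v : ι → ℝ, Tendsto v l (𝓝 0) → Tendsto (fun t => u t * v t) l (𝓝 0) := by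
    intro u hu v hv
    refine squeeze_zero_norm' ?_ (tendsto_zero_iff_norm_tendsto_zero.mp hv)
    filter_upwards [hu] with t ht
    rw [norm_mul, Real.norm_of_nonneg ht.1]
    exact mul_le_of_le_one_left (norm_nonneg _) ht.2
  have hqx : Tendsto (fun t => q t / x t) l (𝓝 a) := by
    have h1 := hmul (fun t => (1 - r t) * r t) (by
      filter_upwards [hspec] with t ht
      constructor <;> nlinarith [ht.1, ht.2.1]) _ hxi
    have h2 := (hA.sub hsx).sub h1
    rw [sub_zero, sub_zero] at h2
    refine h2.congr' ?_
    filter_upwards [hspec] with t ht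
    rw [← ht.2.2.2.1]
    ring
  have hq0 : ∀ᶠ t in l, 0 < q t := by
    filter_upwards [hqlow, hAgt] with t h1 h2
    linarith
  refine ⟨r, q, s, hspec.mono fun t ht => ht.2.2.2, ?_, hqx, ?_⟩
  · have h1 := hmul (fun t => 1 - r t) (by
      filter_upwards [hspec] with t ht
      constructor <;> linarith [ht.1, ht.2.1]) _ hsx
    have h2 := (hB.sub h1).div hqx ha.ne'
    rw [sub_zero] at h2
    refine h2.congr' ?_
    filter_upwards [hspec, hx0, hq0] with t ht h3 h4
    simp only [Pi.div_apply]
    rw [← ht.2.2.2.2.1]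
    field_simp
    ring
  · refine (hC.div hqx ha.ne').congr' ?_
    filter_upwards [hspec, hx0, hy0, hq0] with t ht h2 h3 h4
    simp only [Pi.div_apply]
    rw [← ht.2.2.2.2.2]
    field_simp

/-- The root `-p/2 + i √(q - p²/4)` of `z² + p z + q`, when `p² ≤ 4 q`. -/
noncomputable def quadraticRoot (p q : ℝ) : ℂ := ⟨-p / 2, √(q - p ^ 2 / 4)⟩

theorem quadraticRoot_isRoot {p q : ℝ} (h : p ^ 2 / 4 ≤ q) :
    quadraticRoot p q ^ 2 + p * quadraticRoot p q + q = 0 := by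
  have hs := Real.mul_self_sqrt (sub_nonneg.mpr h)
  apply Complex.ext
  · simp [quadraticRoot, pow_two] at hs ⊢
    linarith
  · simp [quadraticRoot, pow_two]
    ring

theorem tendsto_quadraticRoot_im_div {ι : Type*} {l : Filter ι} {p q w : ι → ℝ} {p₀ k : ℝ}
    (hk : 0 < k) (hp : Tendsto p l (𝓝 p₀)) (hw : Tendsto w l atTop)
    (hq : Tendsto (fun t => q t / w t) l (𝓝 k)) :
    (∀ᶠ t in l, p t ^ 2 / 4 ≤ q t) ∧
      Tendsto (fun t => (quadraticRoot (p t) (q t)).im / (√k * √(w t))) l (𝓝 1) := by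
  have h : Tendsto (fun t => (q t - p t ^ 2 / 4) / w t) l (𝓝 k) := by
    simpa only [sub_div, sub_zero] using hq.sub (((hp.pow 2).div_const 4).div_atTop hw)
  have hw0 := hw.eventually_gt_atTop 0
  constructor
  · filter_upwards [hw0, h.eventually_const_lt hk] with t h1 h2
    have := (div_pos_iff_of_pos_right h1).mp h2
    linarith
  · have h1 := (h.div_const k).sqrt
    rw [div_self hk.ne', Real.sqrt_one] at h1
    refine h1.congr' ?_
    filter_upwards [hw0] with t ht
    rw [div_div, mul_comm (w t) k, Real.sqrt_div' _ (by positivity), Real.sqrt_mul hk.le]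
    rfl

theorem charPoly_conj_eq_zero {α β γ μ : ℝ} {z : ℂ} (h : charPoly α β γ μ z = 0) :
    charPoly α β γ μ ((starRingEnd ℂ) z) = 0 := by
  have := congrArg (starRingEnd ℂ) h
  simpa [charPoly, -Complex.ofReal_add, -Complex.ofReal_mul] using this

theorem charPoly_eq_zero_of_factor {α β γ μ r q s : ℝ} (hD : μ ^ γ + 1 ≠ 0)
    (hA : q + s + (1 - r) * r =
      (μ ^ (2 * α) + μ ^ (β + γ) + 2 * μ + μ ^ β) / (μ ^ γ + 1))
    (hB : (1 - r) * s + r * q = (μ ^ (2 * α) + 2 * μ) / (μ ^ γ + 1))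
    (hC : q * s = 2 * μ ^ (1 + β) / (μ ^ γ + 1)) {z : ℂ}
    (hz : (z ^ 2 + (1 - r : ℝ) * z + q) * (z ^ 2 + r * z + s) = 0) :
    charPoly α β γ μ z = 0 := by
  rw [eq_div_iff hD] at hA hB hC
  rw [charPoly, ← hA, ← hB, ← hC]
  push_cast at hz ⊢
  linear_combination ((μ ^ γ : ℝ) + 1 : ℂ) * hz

theorem charPoly_roots_F13 (α β γ : ℝ)
    (h1 : α = (β + γ) / 2) (h2 : 1 - γ < β) (h3 : β ≤ 1)
    (h4 : 0 < γ) (h5 : γ < 1) :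
    ∃ M > (0 : ℝ), ∃ l1 l3 : ℝ → ℂ,
      (∀ μ > M,
        charPoly α β γ μ (l1 μ) = 0 ∧ charPoly α β γ μ ((starRingEnd ℂ) (l1 μ)) = 0 ∧
        charPoly α β γ μ (l3 μ) = 0 ∧ charPoly α β γ μ ((starRingEnd ℂ) (l3 μ)) = 0) ∧
      Tendsto (fun μ : ℝ => (l1 μ).re / (-(1 / 4) : ℝ)) atTop (𝓝 1) ∧
      Tendsto (fun μ : ℝ => (l1 μ).im / (Real.sqrt 2 * μ ^ (β / 2))) atTop (𝓝 1) ∧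
      Tendsto (fun μ : ℝ => (l3 μ).re / (-(1 / 4) : ℝ)) atTop (𝓝 1) ∧
      Tendsto (fun μ : ℝ => (l3 μ).im / (μ ^ ((1 - γ) / 2))) atTop (𝓝 1) ∧
      ∃ c > (0 : ℝ), ∃ M' : ℝ, ∀ μ > M', (l1 μ).re ≤ -c ∧ (l3 μ).re ≤ -c := by
  have hrpow : ∀ {e : ℝ}, e < 0 → Tendsto (fun μ : ℝ => μ ^ e) atTop (𝓝 0) := fun {e} he => by
    simpa using tendsto_rpow_neg_atTop (neg_pos.mpr he)
  have hγ := hrpow (neg_lt_zero.mpr h4)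
  have hδ := hrpow (show 1 - γ - β < 0 by linarith)
  have hden : Tendsto (fun μ : ℝ => 1 + μ ^ (-γ)) atTop (𝓝 (1 + 0)) := hγ.const_add 1
  have hden0 : (1 + 0 : ℝ) ≠ 0 := by norm_num
  obtain ⟨r, q, s, hfac, hr, hq, hs⟩ :=
    exists_quartic_factorization_tendsto (l := atTop) (x := fun μ : ℝ => μ ^ β)
      (y := fun μ : ℝ => μ ^ (1 - γ))
      (A := fun μ => (μ ^ (2 * α) + μ ^ (β + γ) + 2 * μ + μ ^ β) / (μ ^ γ + 1))
      (B := fun μ => (μ ^ (2 * α) + 2 * μ) / (μ ^ γ + 1))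
      (C := fun μ => 2 * μ ^ (1 + β) / (μ ^ γ + 1))
      (a := 2) (b := 1) (c := 2) one_pos one_lt_two two_pos
      (tendsto_rpow_atTop (by linarith)) (tendsto_rpow_atTop (by linarith))
      (by
        refine hδ.congr' ?_
        filter_upwards [eventually_gt_atTop 0] with μ hμ
        rw [rpow_sub hμ])
      (by
        have h := (((hδ.const_mul 2).const_add 2).add hγ).div hden hden0
        norm_num at h
        refine h.congr' ?_
        filter_upwards [eventually_gt_atTop 0] with μ hμ
        have e : 2 * α = β + γ := by rw [h1]; ring
        have hb := rpow_pos_of_pos hμ β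
        have hg := rpow_pos_of_pos hμ γ
        simp only [Pi.div_apply]
        rw [e, rpow_sub hμ, rpow_sub hμ, rpow_neg hμ.le, rpow_add hμ, rpow_one]
        field_simp
        ring)
      (by
        have h := ((hδ.const_mul 2).const_add 1).div hden hden0
        norm_num at h
        refine h.congr' ?_
        filter_upwards [eventually_gt_atTop 0] with μ hμ
        have e : 2 * α = β + γ := by rw [h1]; ring
        have hb := rpow_pos_of_pos hμ β
        have hg := rpow_pos_of_pos hμ γ
        simp only [Pi.div_apply]
        rw [e, rpow_sub hμ, rpow_sub hμ, rpow_neg hμ.le, rpow_add hμ, rpow_one]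
        field_simp)
      (by
        have h := (tendsto_const_nhds (x := (2 : ℝ))).div hden hden0
        norm_num at h
        refine h.congr' ?_
        filter_upwards [eventually_gt_atTop 0] with μ hμ
        have hb := rpow_pos_of_pos hμ β
        have hg := rpow_pos_of_pos hμ γ
        simp only [Pi.div_apply]
        rw [rpow_sub hμ, rpow_neg hμ.le, rpow_add hμ, rpow_one]
        field_simp)
  rw [div_self two_ne_zero] at hs
  have hp : Tendsto (fun μ => 1 - r μ) atTop (𝓝 (1 / 2)) := by
    have := hr.const_sub 1
    norm_num at this ⊢
    exact this
  obtain ⟨hd1, him1⟩ := tendsto_quadraticRoot_im_div two_pos hp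
    (tendsto_rpow_atTop (show 0 < β by linarith)) hq
  obtain ⟨hd3, him3⟩ := tendsto_quadraticRoot_im_div one_pos hr
    (tendsto_rpow_atTop (show 0 < 1 - γ by linarith)) hs
  have hsqrt : ∀ e : ℝ, ∀ᶠ μ : ℝ in atTop, √(μ ^ e) = μ ^ (e / 2) := fun e => by
    filter_upwards [eventually_ge_atTop 0] with μ hμ
    rw [Real.sqrt_eq_rpow, ← rpow_mul hμ, mul_one_div]
  have hre : ∀ {u : ℝ → ℝ}, Tendsto u atTop (𝓝 (1 / 2)) → ∀ v : ℝ → ℝ,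
      Tendsto (fun μ => (quadraticRoot (u μ) (v μ)).re) atTop (𝓝 (-(1 / 4))) := by
    intro u hu v
    have := hu.neg.div_const 2
    norm_num at this ⊢
    exact this
  have hratio : ∀ {u : ℝ → ℝ}, Tendsto u atTop (𝓝 (-(1 / 4))) →
      Tendsto (fun μ => u μ / (-(1 / 4) : ℝ)) atTop (𝓝 1) := by
    intro u hu
    simpa using hu.div_const (-(1 / 4))
  have hneg : (-(1 / 4) : ℝ) < -(1 / 8) := by norm_num
  have hre1 := hre hp q
  have hre3 := hre hr s
  obtain ⟨M, hM⟩ := eventually_atTop.mp (hfac.and (hd1.and hd3))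
  obtain ⟨M', hM'⟩ := eventually_atTop.mp
    ((hre1.eventually_lt_const hneg).and (hre3.eventually_lt_const hneg))
  refine ⟨max M 1, by positivity, fun μ => quadraticRoot (1 - r μ) (q μ),
    fun μ => quadraticRoot (r μ) (s μ), ?_, hratio hre1, ?_, hratio hre3, ?_,
    1 / 8, by norm_num, M', fun μ hμ => ⟨(hM' μ hμ.le).1.le, (hM' μ hμ.le).2.le⟩⟩
  · intro μ hμ
    obtain ⟨⟨hA, hB, hC⟩, hq1, hs1⟩ := hM μ ((le_max_left _ _).trans hμ.le)
    have hμ0 : 0 < μ := one_pos.trans ((le_max_right _ _).trans_lt hμ)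
    have hD : μ ^ γ + 1 ≠ 0 := by positivity
    have hl1 := charPoly_eq_zero_of_factor hD hA hB hC
      (mul_eq_zero_of_left (quadraticRoot_isRoot hq1) _)
    have hl3 := charPoly_eq_zero_of_factor hD hA hB hC
      (mul_eq_zero_of_right _ (quadraticRoot_isRoot hs1))
    exact ⟨hl1, charPoly_conj_eq_zero hl1, hl3, charPoly_conj_eq_zero hl3⟩
  · refine him1.congr' ?_
    filter_upwards [hsqrt β] with μ hμ
    rw [hμ]
  · refine him3.congr' ?_
    filter_upwards [hsqrt (1 - γ)] with μ hμ
    rw [hμ, Real.sqrt_one, one_mul]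
end

section
/- Assume 0 ≤ α < 1/2, β = 0, and 0 < γ < 1 (region F₂). Then there exist M > 0 and functions λ₁, λ₃ : ℝ → ℂ such that for every μ > M, λ₁(μ), its complex conjugate, λ₃(μ), and its complex conjugate are roots of f(·, μ), and as μ → ∞: Re λ₁(μ) = −(1/8)μ^(2α+γ−2)(1+o(1)), Im λ₁(μ) = √2 · μ^((1−γ)/2)(1+o(1)), Re λ₃(μ) = −(1/2)(1+o(1)), and Im λ₃(μ) = (√3/2)(1+o(1)). -/
open Filter Real Topology

/-- The root of the real quadratic `z² + b z + c` in the closed upper half plane, when its roots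
are not two distinct real numbers. -/
noncomputable def quadRoot (b c : ℝ) : ℂ := ⟨-b / 2, √(c - b ^ 2 / 4)⟩

lemma quadRoot_eq_zero {b c : ℝ} (h : 0 ≤ c - b ^ 2 / 4) :
    quadRoot b c ^ 2 + b * quadRoot b c + c = 0 := by
  have hs := Real.mul_self_sqrt h
  rw [pow_two b] at hs
  apply Complex.ext
  · simp [quadRoot, pow_two]
    linear_combination -hs
  · simp [quadRoot, pow_two]
    ring

lemma quadRoot_conj_eq_zero {b c : ℝ} (h : 0 ≤ c - b ^ 2 / 4) :
    (starRingEnd ℂ) (quadRoot b c) ^ 2 + b * (starRingEnd ℂ) (quadRoot b c) + c = 0 := by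
  simpa using congrArg (starRingEnd ℂ) (quadRoot_eq_zero h)

/-- The real factorisation
`(z² + z + 1)(z² + W) + e (z² + z) = (z² + (1 - r) z + q)(z² + r z + s)`, expressed through its
coefficients, with `s = W + e + t`. -/
structure IsQuarticSplit (W e t r q s : ℝ) : Prop where
  t_nonneg : 0 ≤ t
  t_le : t ≤ 1
  s_eq : s = W + e + t
  q_mul_s : q * s = W
  r_mul : r * (s - q) = t
  q_add : q + t + r - r ^ 2 = 1

lemma exists_isQuarticSplit {W e : ℝ} (hW : 2 < W) (he : 0 < e) :
    ∃ t r q s, IsQuarticSplit W e t r q s := by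
  have hs : ∀ t ∈ Set.Icc (0 : ℝ) 1, 0 < W + e + t := fun t ht => by linarith [ht.1]
  have hq : ∀ t ∈ Set.Icc (0 : ℝ) 1, W / (W + e + t) ≤ 1 := fun t ht => by
    rw [div_le_one (hs t ht)]; linarith [ht.1]
  have hd : ∀ t ∈ Set.Icc (0 : ℝ) 1, 1 < W + e + t - W / (W + e + t) := fun t ht => by
    linarith [hq t ht, ht.1]
  let R : ℝ → ℝ := fun t => t / (W + e + t - W / (W + e + t))
  let F : ℝ → ℝ := fun t => W / (W + e + t) + t + R t - R t ^ 2
  have hcq : ContinuousOn (fun t => W / (W + e + t)) (Set.Icc (0 : ℝ) 1) :=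
    ContinuousOn.div (by fun_prop) (by fun_prop) fun t ht => (hs t ht).ne'
  have hcR : ContinuousOn R (Set.Icc (0 : ℝ) 1) :=
    ContinuousOn.div (by fun_prop) (ContinuousOn.sub (by fun_prop) hcq)
      fun t ht => (zero_lt_one.trans (hd t ht)).ne'
  have hcF : ContinuousOn F (Set.Icc (0 : ℝ) 1) :=
    ((hcq.add continuousOn_id).add hcR).sub (hcR.pow 2)
  have h0 : F 0 ≤ 1 := by
    have := hq 0 (by simp)
    simpa [F, R] using this
  have h1 : 1 ≤ F 1 := by
    have hm : (1 : ℝ) ∈ Set.Icc (0 : ℝ) 1 := by simp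
    have hR0 : 0 ≤ R 1 := div_nonneg zero_le_one (zero_lt_one.trans (hd 1 hm)).le
    have hR1 : R 1 ≤ 1 := (div_le_one (zero_lt_one.trans (hd 1 hm))).2 (hd 1 hm).le
    have : 0 ≤ W / (W + e + 1) := div_nonneg (by linarith) (hs 1 hm).le
    simp only [F]
    nlinarith
  obtain ⟨t, ht, hFt⟩ := intermediate_value_Icc zero_le_one hcF ⟨h0, h1⟩
  exact ⟨t, R t, W / (W + e + t), W + e + t, ht.1, ht.2, rfl,
    div_mul_cancel₀ _ (hs t ht).ne', div_mul_cancel₀ _ (zero_lt_one.trans (hd t ht)).ne', hFt⟩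

lemma IsQuarticSplit.factor {W e t r q s : ℝ} (h : IsQuarticSplit W e t r q s) (z : ℂ) :
    (z ^ 2 + z + 1) * (z ^ 2 + W) + e * (z ^ 2 + z) =
      (z ^ 2 + (1 - r : ℝ) * z + q) * (z ^ 2 + r * z + s) := by
  have h1 : (s : ℂ) = W + e + t := by exact_mod_cast h.s_eq
  have h2 : (q * s : ℂ) = W := by exact_mod_cast h.q_mul_s
  have h3 : (r * (s - q) : ℂ) = t := by exact_mod_cast h.r_mul
  have h4 : (q + t + r - r ^ 2 : ℂ) = 1 := by exact_mod_cast h.q_add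
  push_cast
  linear_combination (-z ^ 2 - z) * h1 - h2 + z * h3 - z ^ 2 * h4

section Asymptotics

variable {ι : Type*} {l : Filter ι} {W e t r q s : ι → ℝ}

lemma tendsto_isQuarticSplit (hW : Tendsto W l atTop) (he : ∀ᶠ x in l, 0 < e x)
    (heW : Tendsto (fun x => e x / W x) l (𝓝 0))
    (h : ∀ᶠ x in l, IsQuarticSplit (W x) (e x) (t x) (r x) (q x) (s x)) :
    Tendsto (fun x => s x / W x) l (𝓝 1) ∧ Tendsto q l (𝓝 1) ∧ Tendsto r l (𝓝 0) ∧
      Tendsto (fun x => r x * W x ^ 2 / e x) l (𝓝 1) := by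
  have hW0 : ∀ᶠ x in l, 2 < W x := hW.eventually_gt_atTop 2
  have hWi : Tendsto (fun x => (W x)⁻¹) l (𝓝 0) := tendsto_inv_atTop_zero.comp hW
  have htW : Tendsto (fun x => t x / W x) l (𝓝 0) := by
    refine tendsto_of_tendsto_of_tendsto_of_le_of_le' tendsto_const_nhds hWi ?_ ?_
    · filter_upwards [hW0, h] with x hx hh
      exact div_nonneg hh.t_nonneg (by linarith)
    · filter_upwards [hW0, h] with x hx hh
      rw [← one_div]
      exact div_le_div_of_nonneg_right hh.t_le (by linarith)
  have hsW : Tendsto (fun x => s x / W x) l (𝓝 1) := by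
    have := (heW.const_add 1).add htW
    simp only [add_zero] at this
    refine this.congr' ?_
    filter_upwards [hW0, h] with x hx hh
    have : W x ≠ 0 := by linarith
    rw [hh.s_eq]
    field_simp
  have hWs : Tendsto (fun x => W x / s x) l (𝓝 1) := by
    simpa using hsW.inv₀ one_ne_zero
  have hs0 : ∀ᶠ x in l, 2 < s x := by
    filter_upwards [hW0, h, he] with x hx hh hx'
    linarith [hh.s_eq, hh.t_nonneg]
  have hq : Tendsto q l (𝓝 1) := by
    refine hWs.congr' ?_
    filter_upwards [hs0, h] with x hx hh
    rw [← hh.q_mul_s, mul_div_cancel_right₀ _ (by linarith)]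
  have hq1 : ∀ᶠ x in l, q x < 2 := hq.eventually_lt_const (by norm_num)
  have hd : Tendsto (fun x => (s x - q x) / W x) l (𝓝 1) := by
    have := hsW.sub (hq.mul hWi)
    simp only [mul_zero, sub_zero] at this
    refine this.congr fun x => ?_
    ring
  have hWd : Tendsto (fun x => W x / (s x - q x)) l (𝓝 1) := by
    simpa using hd.inv₀ one_ne_zero
  have hr : Tendsto r l (𝓝 0) := by
    have := htW.mul hWd
    simp only [zero_mul] at this
    refine this.congr' ?_
    filter_upwards [hW0, h, hs0, hq1] with x hx hh hx1 hx2
    have h1 : W x ≠ 0 := by linarith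
    have h2 : s x - q x ≠ 0 := by linarith
    rw [← hh.r_mul]
    field_simp
  refine ⟨hsW, hq, hr, ?_⟩
  have hsi : Tendsto (fun x => (s x)⁻¹) l (𝓝 0) := by
    have := hWs.mul hWi
    simp only [mul_zero] at this
    refine this.congr' ?_
    filter_upwards [hW0, hs0] with x hx hx1
    have h1 : W x ≠ 0 := by linarith
    field_simp
  have hdi : Tendsto (fun x => (s x - q x)⁻¹) l (𝓝 0) := by
    have := hWd.mul hWi
    simp only [mul_zero] at this
    refine this.congr' ?_
    filter_upwards [hW0] with x hx
    have h1 : W x ≠ 0 := by linarith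
    field_simp
  have hden : Tendsto (fun x => 1 - (s x)⁻¹ + (1 - r x) * (s x - q x)⁻¹) l (𝓝 1) := by
    simpa using (hsi.const_sub 1).add ((hr.const_sub 1).mul hdi)
  have hmain := (hWs.mul hWd).div hden one_ne_zero
  simp only [mul_one, div_one] at hmain
  refine hmain.congr' ?_
  filter_upwards [hW0, h, hs0, hq1, he, hden.eventually_ne one_ne_zero] with x hx hh hx1 hx2 hx3 hx4
  have h1 : W x ≠ 0 := by linarith
  have h2 : s x - q x ≠ 0 := by linarith
  have h3 : s x ≠ 0 := by linarith
  have h4 : e x ≠ 0 := hx3.ne'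
  have key : r x * (s x - q x) * s x * (1 - (s x)⁻¹ + (1 - r x) * (s x - q x)⁻¹) = e x := by
    have e1 : r x * (s x - q x) * s x * (1 - (s x)⁻¹ + (1 - r x) * (s x - q x)⁻¹) =
        r x * (s x - q x) * s x - r x * (s x - q x) + r x * s x * (1 - r x) := by
      field_simp
    rw [e1]
    linear_combination (s x - 1) * hh.r_mul + s x * hh.q_add - hh.q_mul_s + hh.s_eq
  simp only [Pi.div_apply]
  rw [div_eq_div_iff hx4 h4, div_mul_div_comm, div_mul_eq_mul_div, div_eq_iff (mul_ne_zero h3 h2)]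
  linear_combination (-W x ^ 2) * key

end Asymptotics

lemma charPoly_eq_mul_s8 {α γ μ : ℝ} (hμ : 0 < μ) (z : ℂ) :
    charPoly α 0 γ μ z = ((μ ^ γ + 1 : ℝ) : ℂ) *
      ((z ^ 2 + z + 1) * (z ^ 2 + (2 * μ / (μ ^ γ + 1) : ℝ)) +
        (μ ^ (2 * α) / (μ ^ γ + 1) : ℝ) * (z ^ 2 + z)) := by
  have hP : ((μ ^ γ + 1 : ℝ) : ℂ) ≠ 0 := by
    have := Real.rpow_pos_of_pos hμ γ
    exact_mod_cast (by linarith : μ ^ γ + 1 ≠ 0)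
  have h1 : ((2 * μ / (μ ^ γ + 1) : ℝ) : ℂ) * ((μ ^ γ + 1 : ℝ) : ℂ) = ((2 * μ : ℝ) : ℂ) := by
    rw [Complex.ofReal_div, div_mul_cancel₀ _ hP]
  have h2 : ((μ ^ (2 * α) / (μ ^ γ + 1) : ℝ) : ℂ) * ((μ ^ γ + 1 : ℝ) : ℂ) =
      ((μ ^ (2 * α) : ℝ) : ℂ) := by
    rw [Complex.ofReal_div, div_mul_cancel₀ _ hP]
  simp only [charPoly, zero_add, add_zero, Real.rpow_zero, Real.rpow_one]
  push_cast at h1 h2 ⊢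
  linear_combination (-(z ^ 2 + z + 1)) * h1 - (z ^ 2 + z) * h2

theorem charPoly_roots_F2 (α β γ : ℝ)
    (h1 : 0 ≤ α) (h2 : α < 1 / 2) (h3 : β = 0)
    (h4 : 0 < γ) (h5 : γ < 1) :
    ∃ M > (0 : ℝ), ∃ l1 l3 : ℝ → ℂ,
      (∀ μ > M,
        charPoly α β γ μ (l1 μ) = 0 ∧ charPoly α β γ μ ((starRingEnd ℂ) (l1 μ)) = 0 ∧
        charPoly α β γ μ (l3 μ) = 0 ∧ charPoly α β γ μ ((starRingEnd ℂ) (l3 μ)) = 0) ∧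
      Tendsto (fun μ : ℝ => (l1 μ).re / (-(1 / 8) * μ ^ (2 * α + γ - 2))) atTop (𝓝 1) ∧
      Tendsto (fun μ : ℝ => (l1 μ).im / (Real.sqrt 2 * μ ^ ((1 - γ) / 2))) atTop (𝓝 1) ∧
      Tendsto (fun μ : ℝ => (l3 μ).re / (-(1 / 2) : ℝ)) atTop (𝓝 1) ∧
      Tendsto (fun μ : ℝ => (l3 μ).im / (Real.sqrt 3 / 2 : ℝ)) atTop (𝓝 1) := by
  subst h3
  set P : ℝ → ℝ := fun μ => μ ^ γ + 1 with hP
  set W : ℝ → ℝ := fun μ => 2 * μ / P μ with hWdef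
  set e : ℝ → ℝ := fun μ => μ ^ (2 * α) / P μ with hedef
  have hpos : ∀ᶠ μ : ℝ in atTop, 0 < μ := eventually_gt_atTop 0
  have hP0 : ∀ μ : ℝ, 0 < μ → 0 < P μ := fun μ hμ => by
    positivity
  have hPγ : Tendsto (fun μ => P μ / μ ^ γ) atTop (𝓝 1) := by
    have := (tendsto_inv_atTop_zero.comp (tendsto_rpow_atTop h4)).const_add 1
    simp only [add_zero] at this
    refine this.congr' ?_
    filter_upwards [hpos] with μ hμ
    have := (Real.rpow_pos_of_pos hμ γ).ne'
    simp only [Function.comp, hP]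
    field_simp
  have hWγ : Tendsto (fun μ => W μ / (2 * μ ^ (1 - γ))) atTop (𝓝 1) := by
    have := hPγ.inv₀ one_ne_zero
    rw [inv_one] at this
    refine this.congr' ?_
    filter_upwards [hpos] with μ hμ
    have h1 := (Real.rpow_pos_of_pos hμ γ).ne'
    have h2 := (hP0 μ hμ).ne'
    rw [Real.rpow_sub hμ, Real.rpow_one]
    simp only [hWdef]
    field_simp
  have hWtop : Tendsto W atTop atTop := by
    have h1 : Tendsto (fun μ : ℝ => 2 * μ ^ (1 - γ)) atTop atTop :=
      (tendsto_rpow_atTop (sub_pos.2 h5)).const_mul_atTop two_pos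
    refine (hWγ.pos_mul_atTop one_pos h1).congr' ?_
    filter_upwards [hpos] with μ hμ
    have h1 := (Real.rpow_pos_of_pos hμ (1 - γ)).ne'
    field_simp
  have he0 : ∀ μ : ℝ, 0 < μ → 0 < e μ := fun μ hμ =>
    div_pos (Real.rpow_pos_of_pos hμ _) (hP0 μ hμ)
  have heW : Tendsto (fun μ => e μ / W μ) atTop (𝓝 0) := by
    have := (tendsto_rpow_neg_atTop (show 0 < 1 - 2 * α by linarith)).div_const 2
    rw [zero_div] at this
    refine this.congr' ?_
    filter_upwards [hpos] with μ hμ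
    have h2 := (hP0 μ hμ).ne'
    rw [neg_sub, Real.rpow_sub hμ, Real.rpow_one]
    simp only [hWdef, hedef]
    field_simp
  have hex : ∀ μ, ∃ t r q s, 0 < μ → 2 < W μ → IsQuarticSplit (W μ) (e μ) t r q s := by
    intro μ
    by_cases h : 0 < μ ∧ 2 < W μ
    · obtain ⟨t, r, q, s, hh⟩ := exists_isQuarticSplit h.2 (he0 μ h.1)
      exact ⟨t, r, q, s, fun _ _ => hh⟩
    · exact ⟨0, 0, 0, 0, fun h1 h2 => absurd ⟨h1, h2⟩ h⟩
  choose t r q s hsplit using hex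
  have hev : ∀ᶠ μ in atTop, IsQuarticSplit (W μ) (e μ) (t μ) (r μ) (q μ) (s μ) := by
    filter_upwards [hpos, hWtop.eventually_gt_atTop 2] with μ a b using hsplit μ a b
  obtain ⟨hsW, hq, hr, hrW⟩ := tendsto_isQuarticSplit hWtop (hpos.mono he0) heW hev
  have hsγ : Tendsto (fun μ => (s μ - r μ ^ 2 / 4) / (2 * μ ^ (1 - γ))) atTop (𝓝 1) := by
    have h1 := ((hr.pow 2).div_const 4).mul (tendsto_inv_atTop_zero.comp hWtop)
    have h2 := (hsW.sub h1).mul hWγ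
    norm_num at h2
    refine h2.congr' ?_
    filter_upwards [hWtop.eventually_gt_atTop 2] with μ hμ
    have : W μ ≠ 0 := by linarith
    field_simp
  have hdisc : Tendsto (fun μ => q μ - (1 - r μ) ^ 2 / 4) atTop (𝓝 (3 / 4)) := by
    have := hq.sub (((hr.const_sub 1).pow 2).div_const 4)
    norm_num at this
    exact this
  have hroots : ∀ᶠ μ in atTop,
      charPoly α 0 γ μ (quadRoot (r μ) (s μ)) = 0 ∧
      charPoly α 0 γ μ ((starRingEnd ℂ) (quadRoot (r μ) (s μ))) = 0 ∧
      charPoly α 0 γ μ (quadRoot (1 - r μ) (q μ)) = 0 ∧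
      charPoly α 0 γ μ ((starRingEnd ℂ) (quadRoot (1 - r μ) (q μ))) = 0 := by
    filter_upwards [hpos, hev, hsγ.eventually_const_lt one_pos,
      hdisc.eventually_const_lt (show (0 : ℝ) < 3 / 4 by norm_num)] with μ hμ hh hd1 hd2
    have hd1 : 0 ≤ s μ - r μ ^ 2 / 4 := by
      have h1 := Real.rpow_pos_of_pos hμ (1 - γ)
      exact ((div_pos_iff_of_pos_right (by positivity)).1 hd1).le
    have hfac : ∀ z, charPoly α 0 γ μ z = ((P μ : ℝ) : ℂ) *
        ((z ^ 2 + (1 - r μ : ℝ) * z + q μ) * (z ^ 2 + r μ * z + s μ)) := fun z => by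
      rw [← hh.factor, charPoly_eq_mul_s8 hμ]
    simp only [hfac, quadRoot_eq_zero hd1, quadRoot_conj_eq_zero hd1, quadRoot_eq_zero hd2.le,
      quadRoot_conj_eq_zero hd2.le, mul_zero, zero_mul, and_self]
  obtain ⟨M, hM⟩ := eventually_atTop.1 hroots
  refine ⟨max M 1, by positivity, fun μ => quadRoot (r μ) (s μ),
    fun μ => quadRoot (1 - r μ) (q μ),
    fun μ hμ => hM μ ((le_max_left _ _).trans hμ.le), ?_, ?_, ?_, ?_⟩
  · have := hrW.mul hPγ
    rw [mul_one] at this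
    refine this.congr' ?_
    filter_upwards [hpos] with μ hμ
    have h1 := (Real.rpow_pos_of_pos hμ γ).ne'
    have h2 := (hP0 μ hμ).ne'
    have h3 := (Real.rpow_pos_of_pos hμ (2 * α)).ne'
    rw [Real.rpow_sub hμ, Real.rpow_add hμ, Real.rpow_two]
    simp only [quadRoot, hWdef, hedef]
    field_simp
    norm_num
  · have := hsγ.sqrt
    rw [Real.sqrt_one] at this
    refine this.congr' ?_
    filter_upwards [hpos] with μ hμ
    have h1 := Real.rpow_pos_of_pos hμ (1 - γ)
    rw [Real.sqrt_div' _ (by positivity), Real.sqrt_mul zero_le_two,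
      Real.sqrt_eq_rpow (μ ^ (1 - γ)), ← Real.rpow_mul hμ.le]
    simp only [quadRoot]
    ring_nf
  · have := hr.const_sub 1
    rw [sub_zero] at this
    refine this.congr fun μ => ?_
    simp only [quadRoot]
    ring
  · have h3 : √(3 / 4 : ℝ) = √3 / 2 := by
      rw [Real.sqrt_div' _ (by norm_num), show (4 : ℝ) = 2 ^ 2 by norm_num,
        Real.sqrt_sq zero_le_two]
    have := hdisc.sqrt.div_const (√3 / 2)
    rwa [h3, div_self (by positivity)] at this
end
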